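/- arXiv:2412.01139 — 6 statements merged into one kernel-verified Lean document; each statement's English description precedes it below -/
import Mathlib

section
/- Suppose the noise density f is piecewise monotone and its largest global maximizer x_m exists and is a mode of f. Then the following are equivalent: (i) for every prize schedule v ∈ 𝒱 and every t ∈ ℝ, g(t; v) ≤ g(x_m; v); (ii) for every t ∈ ℝ, B_1(t) ≤ B_1(x_m). (The threshold at the global mode is optimal for every prize schedule if and only if it is optimal for the winner-take-all schedule.) -/
open MeasureTheory

/-- The CDF associated with a density `f`. -/
noncomputable def Fcdf (f : ℝ → ℝ) (x : ℝ) : ℝ := ∫ u in Set.Iic x, f u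

/-- `F_{(j:m)}`, the CDF of the `j`-th smallest of `m` i.i.d. draws (binomial-sum form),
with the convention `F_{(0:m)} ≡ 1`. -/
noncomputable def Fos (f : ℝ → ℝ) (j m : ℕ) (x : ℝ) : ℝ :=
  if j = 0 then 1
  else ∑ k ∈ Finset.Icc j m, (m.choose k : ℝ) * Fcdf f x ^ k * (1 - Fcdf f x) ^ (m - k)

/-- `f_{(j:m)}`, the density of the `j`-th smallest of `m` i.i.d. draws,
with the convention `f_{(0:m)} ≡ 0`. -/
noncomputable def fos (f : ℝ → ℝ) (j m : ℕ) (x : ℝ) : ℝ :=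
  if j = 0 then 0
  else (j : ℝ) * (m.choose j : ℝ) * Fcdf f x ^ (j - 1) * (1 - Fcdf f x) ^ (m - j) * f x

/-- The marginal-benefit coefficient `B_r(t)`. -/
noncomputable def Bcoef (f : ℝ → ℝ) (n r : ℕ) (t : ℝ) : ℝ :=
  f t * Fos f (n - r) (n - 1) t + ∫ x in Set.Ioi t, f x * fos f (n - r) (n - 1) x

/-- The marginal benefit of effort `g(t; v)` with threshold `t` and prize schedule `v`. -/
noncomputable def gmb (f : ℝ → ℝ) (n : ℕ) (v : ℕ → ℝ) (t : ℝ) : ℝ :=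
  ∑ r ∈ Finset.Icc 1 n, Bcoef f n r t * (v r - v (r + 1))

/-- A noise density: nonnegative, bounded, integrating to one, vanishing outside
`[xl, xu]` and continuous there.  The endpoints may be infinite. -/
def IsNoiseDensity (f : ℝ → ℝ) (xl xu : EReal) : Prop :=
  xl < xu ∧ (∀ x, 0 ≤ f x) ∧ (∃ M, ∀ x, f x ≤ M) ∧ (∫ x, f x = 1) ∧
    (∀ x : ℝ, ((x : EReal) < xl ∨ xu < (x : EReal)) → f x = 0) ∧
    ContinuousOn f {x : ℝ | xl ≤ (x : EReal) ∧ (x : EReal) ≤ xu}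

/-- A prize schedule `v = (v 1, …, v n)`: nonincreasing, nonnegative, summing to one,
with the convention `v (n+1) = 0`. -/
def IsPrizeSchedule (n : ℕ) (v : ℕ → ℝ) : Prop :=
  (∀ r ∈ Finset.Icc 1 n, 0 ≤ v r) ∧ (∀ r, 1 ≤ r → r < n → v (r + 1) ≤ v r) ∧
    (∑ r ∈ Finset.Icc 1 n, v r = 1) ∧ v (n + 1) = 0

/-- `m` is a mode of `f`. -/
def IsMode (f : ℝ → ℝ) (m : ℝ) : Prop :=
  ∃ a b : ℝ, a < m ∧ m < b ∧ MonotoneOn f (Set.Icc a m) ∧ AntitoneOn f (Set.Icc m b) ∧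
    f a < f m ∧ f b < f m

/-- `f` is piecewise monotone: away from finitely many points it is monotone. -/
def PiecewiseMonotone (f : ℝ → ℝ) : Prop :=
  ∃ s : Finset ℝ, ∀ a b : ℝ, a < b → (∀ c ∈ s, c ∉ Set.Ioo a b) →
    MonotoneOn f (Set.Ioo a b) ∨ AntitoneOn f (Set.Ioo a b)

/-- The probability that a binomial variable with parameters `m` and `p` is at least `j`. -/
noncomputable def binomialTail (j m : ℕ) (p : ℝ) : ℝ :=
  ∑ k ∈ Finset.Icc j m, (m.choose k : ℝ) * p ^ k * (1 - p) ^ (m - k)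

/-- The derivative of `binomialTail j m`, for `1 ≤ j ≤ m`. -/
noncomputable def binomialTailDeriv (j m : ℕ) (p : ℝ) : ℝ :=
  (j : ℝ) * (m.choose j : ℝ) * p ^ (j - 1) * (1 - p) ^ (m - j)

lemma binomialTail_self (m : ℕ) (p : ℝ) : binomialTail m m p = p ^ m := by
  simp [binomialTail]

lemma binomialTail_zero {j : ℕ} (m : ℕ) (hj : 1 ≤ j) : binomialTail j m 0 = 0 := by
  refine Finset.sum_eq_zero fun k hk => ?_
  have hk' : k ≠ 0 := by have := (Finset.mem_Icc.1 hk).1; omega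
  simp [hk']

lemma binomialTail_nonneg (j m : ℕ) {p : ℝ} (h0 : 0 ≤ p) (h1 : p ≤ 1) :
    0 ≤ binomialTail j m p := by
  have := sub_nonneg.2 h1
  exact Finset.sum_nonneg fun k _ => by positivity

lemma continuous_binomialTail (j m : ℕ) : Continuous (binomialTail j m) := by
  unfold binomialTail
  fun_prop

lemma continuous_binomialTailDeriv (j m : ℕ) : Continuous (binomialTailDeriv j m) := by
  unfold binomialTailDeriv
  fun_prop

lemma binomialTailDeriv_nonneg (j m : ℕ) {p : ℝ} (h0 : 0 ≤ p) (h1 : p ≤ 1) :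
    0 ≤ binomialTailDeriv j m p := by
  have := sub_nonneg.2 h1
  unfold binomialTailDeriv
  positivity

lemma binomialTailDeriv_le (j m : ℕ) {p : ℝ} (h0 : 0 ≤ p) (h1 : p ≤ 1) :
    binomialTailDeriv j m p ≤ j * m.choose j := by
  have h2 : 0 ≤ 1 - p := sub_nonneg.2 h1
  have ha : p ^ (j - 1) ≤ 1 := pow_le_one₀ h0 h1
  have hb : (1 - p) ^ (m - j) ≤ 1 := pow_le_one₀ h2 (by linarith)
  unfold binomialTailDeriv
  rw [mul_assoc]
  exact mul_le_of_le_one_right (by positivity) (mul_le_one₀ ha (by positivity) hb)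

lemma hasDerivAt_binomialTail {j m : ℕ} (hj : 1 ≤ j) (hjm : j ≤ m) (p : ℝ) :
    HasDerivAt (binomialTail j m) (binomialTailDeriv j m p) p := by
  have key : binomialTail j m =
      fun q => (∑ k ∈ Finset.Icc j m, bernsteinPolynomial ℝ m k).eval q := by
    funext q
    simp [binomialTail, bernsteinPolynomial, Polynomial.eval_finsetSum]
  rw [key]
  refine (∑ k ∈ Finset.Icc j m, bernsteinPolynomial ℝ m k).hasDerivAt p |>.congr_deriv ?_
  clear key
  obtain ⟨i, rfl⟩ : ∃ i, j = i + 1 := ⟨j - 1, by omega⟩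
  obtain ⟨l, rfl⟩ : ∃ l, m = l + 1 := ⟨m - 1, by omega⟩
  have hil : i ≤ l := by omega
  have hsum : Polynomial.derivative
      (∑ k ∈ Finset.Icc (i + 1) (l + 1), bernsteinPolynomial ℝ (l + 1) k) =
      ((l + 1 : ℕ) : Polynomial ℝ) * bernsteinPolynomial ℝ l i := by
    rw [Polynomial.derivative_sum]
    have h1 : ∑ k ∈ Finset.Icc (i + 1) (l + 1),
        Polynomial.derivative (bernsteinPolynomial ℝ (l + 1) k) =
        ∑ k ∈ Finset.Ico i (l + 1), ((l + 1 : ℕ) : Polynomial ℝ) *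
          (bernsteinPolynomial ℝ l k - bernsteinPolynomial ℝ l (k + 1)) := by
      rw [← Finset.Ico_add_one_right_eq_Icc, ← Finset.sum_Ico_add']
      refine Finset.sum_congr rfl fun k _ => ?_
      rw [bernsteinPolynomial.derivative_succ]
      rfl
    rw [h1, ← Finset.mul_sum]
    congr 1
    have h2 := Finset.sum_Ico_sub (fun k => bernsteinPolynomial ℝ l k) (show i ≤ l + 1 by omega)
    have h3 : bernsteinPolynomial ℝ l (l + 1) = 0 := by simp [bernsteinPolynomial]
    rw [h3] at h2
    rw [← neg_inj, ← Finset.sum_neg_distrib]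
    simpa using h2
  have hc : ((l : ℝ) + 1) * (l.choose i : ℝ) = ((l + 1).choose (i + 1) : ℝ) * ((i : ℝ) + 1) := by
    exact_mod_cast Nat.add_one_mul_choose_eq l i
  rw [hsum]
  simp only [binomialTailDeriv, bernsteinPolynomial, Polynomial.eval_mul, Polynomial.eval_pow,
    Polynomial.eval_natCast, Polynomial.eval_X, Polynomial.eval_sub, Polynomial.eval_one,
    Nat.add_sub_cancel, Nat.add_sub_add_right]
  push_cast
  linear_combination (p ^ i * (1 - p) ^ (l - i)) * hc

lemma mul_binomialTailDeriv_le {j m : ℕ} (hj : 1 ≤ j) (hjm : j ≤ m) {p : ℝ} (h0 : 0 ≤ p)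
    (h1 : p ≤ 1) : p * binomialTailDeriv j m p ≤ m * binomialTail j m p := by
  have h2 : 0 ≤ 1 - p := sub_nonneg.2 h1
  have hterm : (m.choose j : ℝ) * p ^ j * (1 - p) ^ (m - j) ≤ binomialTail j m p :=
    Finset.single_le_sum (f := fun k => (m.choose k : ℝ) * p ^ k * (1 - p) ^ (m - k))
      (fun k _ => by positivity) (Finset.mem_Icc.2 ⟨le_rfl, hjm⟩)
  have hp : p * p ^ (j - 1) = p ^ j := mul_pow_sub_one (by omega) p
  calc p * binomialTailDeriv j m p
      = j * ((m.choose j : ℝ) * p ^ j * (1 - p) ^ (m - j)) := by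
        rw [← hp, binomialTailDeriv]; ring
    _ ≤ m * ((m.choose j : ℝ) * p ^ j * (1 - p) ^ (m - j)) := by
        have : (j : ℝ) ≤ m := by exact_mod_cast hjm
        gcongr
    _ ≤ m * binomialTail j m p := by gcongr

lemma Fos_eq_binomialTail (f : ℝ → ℝ) {j : ℕ} (m : ℕ) (hj : 1 ≤ j) (x : ℝ) :
    Fos f j m x = binomialTail j m (Fcdf f x) := by
  rw [Fos, if_neg (by omega), binomialTail]

lemma fos_eq_binomialTailDeriv (f : ℝ → ℝ) {j : ℕ} (m : ℕ) (hj : 1 ≤ j) (x : ℝ) :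
    fos f j m x = binomialTailDeriv j m (Fcdf f x) * f x := by
  rw [fos, if_neg (by omega), binomialTailDeriv]

namespace IsNoiseDensity

variable {f : ℝ → ℝ} {xl xu : EReal}

lemma nonneg (hf : IsNoiseDensity f xl xu) (x : ℝ) : 0 ≤ f x := hf.2.1 x

lemma integrable (hf : IsNoiseDensity f xl xu) : Integrable f := by
  by_contra h
  have := hf.2.2.2.1
  rw [integral_undef h] at this
  exact zero_ne_one this

lemma eq_zero_of_lt (hf : IsNoiseDensity f xl xu) {x : ℝ} (hx : (x : EReal) < xl) : f x = 0 :=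
  hf.2.2.2.2.1 x (Or.inl hx)

lemma eq_zero_of_gt (hf : IsNoiseDensity f xl xu) {x : ℝ} (hx : xu < (x : EReal)) : f x = 0 :=
  hf.2.2.2.2.1 x (Or.inr hx)

lemma continuousAt (hf : IsNoiseDensity f xl xu) {x : ℝ} (hl : (x : EReal) ≠ xl)
    (hu : (x : EReal) ≠ xu) : ContinuousAt f x := by
  have hc : Continuous fun y : ℝ => (y : EReal) := continuous_coe_real_ereal
  rcases lt_or_gt_of_ne hl with hl | hl
  · have : f =ᶠ[nhds x] fun _ => 0 := by
      filter_upwards [(isOpen_lt hc continuous_const).mem_nhds hl] with y hy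
      exact hf.eq_zero_of_lt hy
    exact this.continuousAt
  rcases lt_or_gt_of_ne hu with hu | hu
  · refine hf.2.2.2.2.2.continuousAt ?_
    filter_upwards [(isOpen_lt continuous_const hc).mem_nhds hl,
      (isOpen_lt hc continuous_const).mem_nhds hu] with y hy hy'
    exact ⟨le_of_lt hy, le_of_lt hy'⟩
  · have : f =ᶠ[nhds x] fun _ => 0 := by
      filter_upwards [(isOpen_lt continuous_const hc).mem_nhds hu] with y hy
      exact hf.eq_zero_of_gt hy
    exact this.continuousAt

lemma Fcdf_eq (hf : IsNoiseDensity f xl xu) (a : ℝ) :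
    Fcdf f = fun x => Fcdf f a + ∫ u in a..x, f u := by
  funext x
  have := intervalIntegral.integral_Iic_sub_Iic (a := a) (b := x)
    hf.integrable.integrableOn hf.integrable.integrableOn
  rw [← this, Fcdf, Fcdf]
  ring

lemma continuous_Fcdf (hf : IsNoiseDensity f xl xu) : Continuous (Fcdf f) := by
  rw [hf.Fcdf_eq 0]
  exact continuous_const.add
    (intervalIntegral.continuous_primitive (fun _ _ => hf.integrable.intervalIntegrable) 0)

lemma hasDerivAt_Fcdf (hf : IsNoiseDensity f xl xu) {x : ℝ} (hl : (x : EReal) ≠ xl)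
    (hu : (x : EReal) ≠ xu) : HasDerivAt (Fcdf f) (f x) x := by
  rw [hf.Fcdf_eq 0]
  exact (intervalIntegral.integral_hasDerivAt_right hf.integrable.intervalIntegrable
    hf.integrable.aestronglyMeasurable.stronglyMeasurableAtFilter
    (hf.continuousAt hl hu)).const_add _

lemma Fcdf_nonneg (hf : IsNoiseDensity f xl xu) (x : ℝ) : 0 ≤ Fcdf f x :=
  integral_nonneg hf.nonneg

lemma Fcdf_le_one (hf : IsNoiseDensity f xl xu) (x : ℝ) : Fcdf f x ≤ 1 := by
  rw [← hf.2.2.2.1]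
  exact setIntegral_le_integral hf.integrable (Filter.Eventually.of_forall hf.nonneg)

lemma monotone_Fcdf (hf : IsNoiseDensity f xl xu) : Monotone (Fcdf f) := fun _ _ h =>
  setIntegral_mono_set hf.integrable.integrableOn (Filter.Eventually.of_forall hf.nonneg)
    (Set.Iic_subset_Iic.2 h).eventuallyLE

lemma mul_fos_nonneg (hf : IsNoiseDensity f xl xu) {j : ℕ} (m : ℕ) (hj : 1 ≤ j) (x : ℝ) :
    0 ≤ f x * fos f j m x := by
  rw [fos_eq_binomialTailDeriv f m hj]
  exact mul_nonneg (hf.nonneg x) (mul_nonneg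
    (binomialTailDeriv_nonneg j m (hf.Fcdf_nonneg x) (hf.Fcdf_le_one x)) (hf.nonneg x))

lemma integrable_fos (hf : IsNoiseDensity f xl xu) {j : ℕ} (m : ℕ) (hj : 1 ≤ j) :
    Integrable (fos f j m) := by
  have : fos f j m = fun x => binomialTailDeriv j m (Fcdf f x) * f x :=
    funext (fos_eq_binomialTailDeriv f m hj)
  rw [this]
  refine hf.integrable.bdd_mul (c := j * m.choose j)
    ((continuous_binomialTailDeriv j m).comp hf.continuous_Fcdf).aestronglyMeasurable
    (Filter.Eventually.of_forall fun x => ?_)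
  rw [Real.norm_of_nonneg (binomialTailDeriv_nonneg j m (hf.Fcdf_nonneg x) (hf.Fcdf_le_one x))]
  exact binomialTailDeriv_le j m (hf.Fcdf_nonneg x) (hf.Fcdf_le_one x)

lemma integrable_mul_fos (hf : IsNoiseDensity f xl xu) {j : ℕ} (m : ℕ) (hj : 1 ≤ j) :
    Integrable (fun x => f x * fos f j m x) := by
  obtain ⟨M, hM⟩ := hf.2.2.1
  refine (hf.integrable_fos m hj).bdd_mul (c := M) hf.integrable.aestronglyMeasurable
    (Filter.Eventually.of_forall fun x => ?_)
  rw [Real.norm_of_nonneg (hf.nonneg x)]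
  exact hM x

lemma continuous_primitive_mul_fos (hf : IsNoiseDensity f xl xu) {j : ℕ} (m : ℕ) (hj : 1 ≤ j)
    (a : ℝ) : Continuous fun x => ∫ u in a..x, f u * fos f j m u :=
  intervalIntegral.continuous_primitive
    (fun _ _ => (hf.integrable_mul_fos m hj).intervalIntegrable) a

lemma hasDerivAt_primitive_mul_fos (hf : IsNoiseDensity f xl xu) {j : ℕ} (m : ℕ) (hj : 1 ≤ j)
    (a : ℝ) {x : ℝ} (hl : (x : EReal) ≠ xl) (hu : (x : EReal) ≠ xu) :
    HasDerivAt (fun y => ∫ u in a..y, f u * fos f j m u) (f x * fos f j m x) x := by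
  refine intervalIntegral.integral_hasDerivAt_right
    (hf.integrable_mul_fos m hj).intervalIntegrable
    (hf.integrable_mul_fos m hj).aestronglyMeasurable.stronglyMeasurableAtFilter ?_
  have : fos f j m = fun x => binomialTailDeriv j m (Fcdf f x) * f x :=
    funext (fos_eq_binomialTailDeriv f m hj)
  rw [this]
  have hc := hf.continuousAt hl hu
  exact hc.mul
    (((continuous_binomialTailDeriv j m).comp hf.continuous_Fcdf).continuousAt.mul hc)

lemma integral_fos (hf : IsNoiseDensity f xl xu) {j m : ℕ} (hj : 1 ≤ j) (hjm : j ≤ m) {s t : ℝ}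
    (hst : s ≤ t) :
    ∫ x in s..t, fos f j m x = binomialTail j m (Fcdf f t) - binomialTail j m (Fcdf f s) := by
  refine integral_eq_of_hasDerivAt_off_countable_of_le
    (fun x => binomialTail j m (Fcdf f x)) _ hst
    (s := {xl.toReal, xu.toReal}) (Set.toFinite _).countable
    ((continuous_binomialTail j m).comp hf.continuous_Fcdf).continuousOn (fun x hx => ?_)
    (hf.integrable_fos m hj).intervalIntegrable
  have hne : x ≠ xl.toReal ∧ x ≠ xu.toReal := by simpa using hx.2
  rw [fos_eq_binomialTailDeriv f m hj]
  refine (hasDerivAt_binomialTail hj hjm _).comp x (hf.hasDerivAt_Fcdf ?_ ?_)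
  · rintro rfl
    exact hne.1 (EReal.toReal_coe x).symm
  · rintro rfl
    exact hne.2 (EReal.toReal_coe x).symm

lemma integral_mul_fos_le (hf : IsNoiseDensity f xl xu) {j m : ℕ} (hj : 1 ≤ j) (hjm : j ≤ m)
    {M s t : ℝ} (hM : ∀ x, f x ≤ M) (hst : s ≤ t) :
    ∫ x in s..t, f x * fos f j m x ≤
      M * (binomialTail j m (Fcdf f t) - binomialTail j m (Fcdf f s)) := by
  rw [← hf.integral_fos hj hjm hst, ← intervalIntegral.integral_const_mul]
  refine intervalIntegral.integral_mono_on hst (hf.integrable_mul_fos m hj).intervalIntegrable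
    ((hf.integrable_fos m hj).intervalIntegrable.const_mul M) fun x _ => ?_
  refine mul_le_mul_of_nonneg_right (hM x) ?_
  rw [fos_eq_binomialTailDeriv f m hj]
  exact mul_nonneg (binomialTailDeriv_nonneg j m (hf.Fcdf_nonneg x) (hf.Fcdf_le_one x))
    (hf.nonneg x)

lemma integral_Ioi_mul_fos (hf : IsNoiseDensity f xl xu) {j : ℕ} (m : ℕ) (hj : 1 ≤ j) (s t : ℝ) :
    ∫ x in Set.Ioi s, f x * fos f j m x =
      (∫ x in s..t, f x * fos f j m x) + ∫ x in Set.Ioi t, f x * fos f j m x :=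
  (intervalIntegral.integral_interval_add_Ioi (hf.integrable_mul_fos m hj).integrableOn
    (hf.integrable_mul_fos m hj).integrableOn).symm

lemma integral_Ioi_mul_fos_anti (hf : IsNoiseDensity f xl xu) {j : ℕ} (m : ℕ) (hj : 1 ≤ j)
    {s t : ℝ} (hst : s ≤ t) :
    ∫ x in Set.Ioi t, f x * fos f j m x ≤ ∫ x in Set.Ioi s, f x * fos f j m x :=
  setIntegral_mono_set (hf.integrable_mul_fos m hj).integrableOn
    (Filter.Eventually.of_forall fun x => hf.mul_fos_nonneg m hj x)
    (Set.Ioi_subset_Ioi hst).eventuallyLE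

/-- Integration by parts against the decreasing weight `binomialTail j m (F s) / F s ^ m`, as a
monotonicity statement. -/
lemma antitoneOn_weighted (hf : IsNoiseDensity f xl xu) {j m : ℕ} (hj : 1 ≤ j) (hjm : j ≤ m)
    {c a s₀ t : ℝ} (hs₀ : xl ≤ (s₀ : EReal)) (ht : (t : EReal) ≤ xu) (hF : 0 < Fcdf f s₀)
    (hA : ∀ s ∈ Set.Ioo s₀ t, f s * Fcdf f s ^ m ≤ c + ∫ x in a..s, f x * fos f m m x) :
    AntitoneOn (fun s => binomialTail j m (Fcdf f s) / Fcdf f s ^ m *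
      (c + ∫ x in a..s, f x * fos f m m x) - ∫ x in a..s, f x * fos f j m x)
      (Set.Icc s₀ t) := by
  have hm : 1 ≤ m := hj.trans hjm
  have hpos : ∀ s, s₀ ≤ s → 0 < Fcdf f s := fun s hs => hF.trans_le (hf.monotone_Fcdf hs)
  refine antitoneOn_of_hasDerivWithinAt_nonpos (convex_Icc s₀ t)
    (f' := fun s => (binomialTailDeriv j m (Fcdf f s) * f s * Fcdf f s ^ m -
      binomialTail j m (Fcdf f s) * (m * Fcdf f s ^ (m - 1) * f s)) / (Fcdf f s ^ m) ^ 2 *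
      (c + ∫ x in a..s, f x * fos f m m x) + binomialTail j m (Fcdf f s) / Fcdf f s ^ m *
      (f s * fos f m m s) - f s * fos f j m s) ?_ ?_ ?_
  · refine ContinuousOn.sub (ContinuousOn.mul (ContinuousOn.div
      ((continuous_binomialTail j m).comp hf.continuous_Fcdf).continuousOn
      (hf.continuous_Fcdf.pow m).continuousOn fun s hs => ?_)
      (continuous_const.add (hf.continuous_primitive_mul_fos m hm a)).continuousOn)
      (hf.continuous_primitive_mul_fos m hj a).continuousOn
    exact (pow_pos (hpos s hs.1) m).ne'
  · intro s hs
    rw [interior_Icc] at hs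
    have hl : (s : EReal) ≠ xl := (hs₀.trans_lt (EReal.coe_lt_coe_iff.2 hs.1)).ne'
    have hu : (s : EReal) ≠ xu := ((EReal.coe_lt_coe_iff.2 hs.2).trans_le ht).ne
    have dF := hf.hasDerivAt_Fcdf hl hu
    exact ((((hasDerivAt_binomialTail hj hjm _).comp s dF).div (dF.pow m)
      (pow_pos (hpos s hs.1.le) m).ne').mul
      ((hf.hasDerivAt_primitive_mul_fos m hm a hl hu).const_add c)).sub
      (hf.hasDerivAt_primitive_mul_fos m hj a hl hu) |>.hasDerivWithinAt
  · intro s hs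
    rw [interior_Icc] at hs
    have hAs := hA s hs
    have hp := hpos s hs.1.le
    have hmul := mul_binomialTailDeriv_le hj hjm hp.le (hf.Fcdf_le_one s)
    rw [fos_eq_binomialTailDeriv f m hj, fos_eq_binomialTailDeriv f m hm]
    have hfm : binomialTailDeriv m m (Fcdf f s) = m * Fcdf f s ^ (m - 1) := by
      simp [binomialTailDeriv]
    rw [hfm]
    have hfs := hf.nonneg s
    have hpm : Fcdf f s * Fcdf f s ^ (m - 1) = Fcdf f s ^ m := mul_pow_sub_one (by omega) _
    have hq : 0 < Fcdf f s ^ (m - 1) := pow_pos hp _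
    generalize (∫ x in a..s, f x * fos f m m x) = I at *
    generalize Fcdf f s ^ (m - 1) = q at *
    generalize binomialTail j m (Fcdf f s) = G at *
    generalize binomialTailDeriv j m (Fcdf f s) = D at *
    rw [← hpm] at hAs ⊢
    generalize Fcdf f s = p at *
    have heq : (D * f s * (p * q) - G * (m * q * f s)) / (p * q) ^ 2 * (c + I) +
        G / (p * q) * (f s * (m * q * f s)) - f s * (D * f s) =
        -((m * G - p * D) * f s * (c + I - f s * (p * q)) * (q / (p * q) ^ 2)) := by
      field_simp
      ring
    rw [heq, neg_nonpos]
    exact mul_nonneg (mul_nonneg (mul_nonneg (sub_nonneg.2 hmul) hfs) (sub_nonneg.2 hAs))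
      (by positivity)

end IsNoiseDensity

section GlobalMaximizer

variable {f : ℝ → ℝ} {xl xu : EReal} {j m : ℕ} {z t : ℝ}

lemma order_statistic_benefit_le_of_le (hf : IsNoiseDensity f xl xu) (hj : 1 ≤ j) (hjm : j ≤ m)
    (hmax : ∀ x, f x ≤ f z) (ht : t ≤ z) :
    f t * Fos f j m t + ∫ x in Set.Ioi t, f x * fos f j m x ≤
      f z * Fos f j m z + ∫ x in Set.Ioi z, f x * fos f j m x := by
  have h1 := hf.integral_mul_fos_le hj hjm hmax ht
  rw [hf.integral_Ioi_mul_fos m hj t z, Fos_eq_binomialTail f m hj, Fos_eq_binomialTail f m hj]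
  have h2 := mul_le_mul_of_nonneg_right (hmax t)
    (binomialTail_nonneg j m (hf.Fcdf_nonneg t) (hf.Fcdf_le_one t))
  linarith

lemma order_statistic_benefit_le_add (hf : IsNoiseDensity f xl xu) (hj : 1 ≤ j) (hjm : j ≤ m)
    (hmax : ∀ x, f x ≤ f z) (hz : xl ≤ (z : EReal)) (htu : (t : EReal) ≤ xu)
    (hB : ∀ s, f s * Fos f m m s + ∫ x in Set.Ioi s, f x * fos f m m x ≤
      f z * Fos f m m z + ∫ x in Set.Ioi z, f x * fos f m m x)
    {s : ℝ} (hzs : z ≤ s) (hst : s ≤ t) (hF : 0 < Fcdf f s) :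
    f t * Fos f j m t + ∫ x in Set.Ioi t, f x * fos f j m x ≤
      f z * binomialTail j m (Fcdf f s) + ∫ x in Set.Ioi z, f x * fos f j m x := by
  have hm : 1 ≤ m := hj.trans hjm
  have hA : ∀ r, f r * Fcdf f r ^ m ≤
      f z * Fcdf f z ^ m + ∫ x in z..r, f x * fos f m m x := fun r => by
    have h := hB r
    rw [hf.integral_Ioi_mul_fos m hm z r, Fos_eq_binomialTail f m hm,
      Fos_eq_binomialTail f m hm, binomialTail_self, binomialTail_self] at h
    linarith
  have hanti := hf.antitoneOn_weighted hj hjm (hz.trans (EReal.coe_le_coe_iff.2 hzs)) htu hF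
    (fun r _ => hA r) (Set.left_mem_Icc.2 hst) (Set.right_mem_Icc.2 hst) hst
  simp only at hanti
  have hFt : 0 < Fcdf f t := hF.trans_le (hf.monotone_Fcdf hst)
  have hGs := binomialTail_nonneg j m (hf.Fcdf_nonneg s) (hf.Fcdf_le_one s)
  have hGt := binomialTail_nonneg j m (hf.Fcdf_nonneg t) (hf.Fcdf_le_one t)
  have hlow : f t * binomialTail j m (Fcdf f t) ≤
      binomialTail j m (Fcdf f t) / Fcdf f t ^ m *
        (f z * Fcdf f z ^ m + ∫ x in z..t, f x * fos f m m x) := by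
    refine le_trans (le_of_eq ?_)
      (mul_le_mul_of_nonneg_left (hA t) (div_nonneg hGt (pow_pos hFt m).le))
    field_simp
  have hup : binomialTail j m (Fcdf f s) / Fcdf f s ^ m *
        (f z * Fcdf f z ^ m + ∫ x in z..s, f x * fos f m m x) ≤
      f z * binomialTail j m (Fcdf f s) := by
    have h := hf.integral_mul_fos_le hm le_rfl hmax hzs
    rw [binomialTail_self, binomialTail_self] at h
    refine le_trans (mul_le_mul_of_nonneg_left (c := f z * Fcdf f s ^ m) (by linarith)
      (div_nonneg hGs (pow_pos hF m).le)) (le_of_eq ?_)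
    field_simp
  have hI : 0 ≤ ∫ x in z..s, f x * fos f j m x :=
    intervalIntegral.integral_nonneg hzs fun x _ => hf.mul_fos_nonneg m hj x
  rw [Fos_eq_binomialTail f m hj, hf.integral_Ioi_mul_fos m hj z t]
  linarith

lemma order_statistic_benefit_le (hf : IsNoiseDensity f xl xu) (hj : 1 ≤ j) (hjm : j ≤ m)
    (hmax : ∀ x, f x ≤ f z) (hz : xl ≤ (z : EReal))
    (hB : ∀ s, f s * Fos f m m s + ∫ x in Set.Ioi s, f x * fos f m m x ≤
      f z * Fos f m m z + ∫ x in Set.Ioi z, f x * fos f m m x) (t : ℝ) :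
    f t * Fos f j m t + ∫ x in Set.Ioi t, f x * fos f j m x ≤
      f z * Fos f j m z + ∫ x in Set.Ioi z, f x * fos f j m x := by
  rcases le_total t z with htz | hzt
  · exact order_statistic_benefit_le_of_le hf hj hjm hmax htz
  have hGz : 0 ≤ f z * binomialTail j m (Fcdf f z) :=
    mul_nonneg (hf.nonneg z) (binomialTail_nonneg j m (hf.Fcdf_nonneg z) (hf.Fcdf_le_one z))
  have hanti := hf.integral_Ioi_mul_fos_anti m hj hzt
  rcases lt_or_ge xu (t : EReal) with htu | htu
  · rw [hf.eq_zero_of_gt htu, Fos_eq_binomialTail f m hj z]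
    linarith
  rcases (hf.Fcdf_nonneg t).eq_or_lt with hFt | hFt
  · rw [Fos_eq_binomialTail f m hj, Fos_eq_binomialTail f m hj, ← hFt, binomialTail_zero m hj]
    linarith
  have key := fun s => order_statistic_benefit_le_add hf hj hjm hmax hz htu hB (s := s)
  rcases (hf.Fcdf_nonneg z).eq_or_lt with hFz | hFz
  · have hlim : Filter.Tendsto
        (fun p => f z * binomialTail j m p + ∫ x in Set.Ioi z, f x * fos f j m x)
        (nhdsWithin 0 (Set.Ioi 0))
        (nhds (f z * binomialTail j m 0 + ∫ x in Set.Ioi z, f x * fos f j m x)) :=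
      ((continuous_const.mul (continuous_binomialTail j m)).add
        continuous_const).continuousAt.tendsto.mono_left nhdsWithin_le_nhds
    rw [Fos_eq_binomialTail f m hj z, ← hFz]
    refine ge_of_tendsto hlim ?_
    filter_upwards [Ioc_mem_nhdsGT hFt] with p hp
    obtain ⟨s, hs, rfl⟩ := intermediate_value_Icc hzt hf.continuous_Fcdf.continuousOn
      ⟨hFz ▸ hp.1.le, hp.2⟩
    exact key s hs.1 hs.2 hp.1
  · rw [Fos_eq_binomialTail f m hj z]
    exact key z le_rfl hzt hFz

end GlobalMaximizer

/-- The winner-take-all prize schedule. -/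
noncomputable def winnerTakeAll (r : ℕ) : ℝ := if r = 1 then 1 else 0

lemma isPrizeSchedule_winnerTakeAll {n : ℕ} (hn : 1 ≤ n) : IsPrizeSchedule n winnerTakeAll := by
  refine ⟨fun r _ => ?_, fun r hr _ => ?_, ?_, ?_⟩
  · unfold winnerTakeAll; split_ifs <;> norm_num
  · have : r ≠ 0 := by omega
    unfold winnerTakeAll; split_ifs <;> simp_all
  · simp [winnerTakeAll, hn]
  · have : n ≠ 0 := by omega
    simp [winnerTakeAll, this]

lemma gmb_winnerTakeAll (f : ℝ → ℝ) {n : ℕ} (hn : 1 ≤ n) (t : ℝ) :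
    gmb f n winnerTakeAll t = Bcoef f n 1 t := by
  rw [gmb, Finset.sum_eq_single_of_mem 1 (Finset.mem_Icc.2 ⟨le_rfl, hn⟩)]
  · simp [winnerTakeAll]
  · intro r hr hr1
    have hr0 : r ≠ 0 := by have := (Finset.mem_Icc.1 hr).1; omega
    simp [winnerTakeAll, hr1, hr0]

/-- The threshold at the (largest) global mode is optimal for every prize
schedule if and only if it is optimal for the winner-take-all schedule, i.e. iff `B_1` is
maximized at the global mode. -/
theorem stmt10 (n : ℕ) (hn : 2 ≤ n) (f : ℝ → ℝ) (xl xu : EReal)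
    (hf : IsNoiseDensity f xl xu) (hpm : PiecewiseMonotone f)
    (xm : ℝ) (hmax : ∀ x, f x ≤ f xm) (hlargest : ∀ x, f x = f xm → x ≤ xm)
    (hmode : IsMode f xm) :
    (∀ v : ℕ → ℝ, IsPrizeSchedule n v → ∀ t : ℝ, gmb f n v t ≤ gmb f n v xm) ↔
      ∀ t : ℝ, Bcoef f n 1 t ≤ Bcoef f n 1 xm := by
  have hn1 : 1 ≤ n := by omega
  constructor
  · intro h t
    have := h winnerTakeAll (isPrizeSchedule_winnerTakeAll hn1) t
    rwa [gmb_winnerTakeAll f hn1, gmb_winnerTakeAll f hn1] at this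
  · rintro hB v ⟨hv0, hvmono, -, hvlast⟩ t
    have hxm : xl ≤ (xm : EReal) := by
      obtain ⟨a, -, -, -, -, -, ha, -⟩ := hmode
      by_contra! hlt
      rw [hf.eq_zero_of_lt hlt] at ha
      exact absurd (hf.nonneg a) (not_le.2 ha)
    refine Finset.sum_le_sum fun r hr => ?_
    obtain ⟨hr1, hrn⟩ := Finset.mem_Icc.1 hr
    refine mul_le_mul_of_nonneg_right ?_ (sub_nonneg.2 ?_)
    · rcases hrn.eq_or_lt with rfl | hrn
      · simpa [Bcoef, Fos, fos] using hmax t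
      · exact order_statistic_benefit_le hf (by omega) (by omega) hmax hxm hB t
    · rcases hrn.eq_or_lt with rfl | hrn
      · rw [hvlast]; exact hv0 r hr
      · exact hvmono r hr1 hrn
end

section
/- Let μ be a measure on ℝ, let g₁, g₂ : ℝ → [0, ∞), and suppose g₁ = ρ·g₂ for some nonincreasing function ρ : ℝ → [0, ∞) (so g₂ dominates g₁ in the likelihood-ratio order). Let φ : ℝ → ℝ be such that φ·g₁ and φ·g₂ are μ-integrable, and suppose φ is single-crossing from nonnegative to nonpositive: there exists x₀ ∈ ℝ with φ(x) ≥ 0 for all x ≤ x₀ and φ(x) ≤ 0 for all x ≥ x₀. If ∫ φ·g₂ dμ ≥ 0, then ∫ φ·g₁ dμ ≥ 0. -/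
open MeasureTheory

/-- If `g₁ = ρ · g₂` with `ρ` nonincreasing and nonnegative (likelihood-ratio
dominance of `g₂` over `g₁`), and `φ` is single-crossing from nonnegative to nonpositive,
then `∫ φ g₂ dμ ≥ 0` implies `∫ φ g₁ dμ ≥ 0`. -/
theorem stmt11 (μ : Measure ℝ) (g₁ g₂ : ℝ → ℝ)
    (hg₁ : ∀ x, 0 ≤ g₁ x) (hg₂ : ∀ x, 0 ≤ g₂ x)
    (ρ : ℝ → ℝ) (hρ0 : ∀ x, 0 ≤ ρ x) (hρ : ∀ x y : ℝ, x ≤ y → ρ y ≤ ρ x)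
    (hratio : ∀ x, g₁ x = ρ x * g₂ x)
    (φ : ℝ → ℝ)
    (hint₁ : Integrable (fun x => φ x * g₁ x) μ)
    (hint₂ : Integrable (fun x => φ x * g₂ x) μ)
    (x₀ : ℝ) (hsc₁ : ∀ x : ℝ, x ≤ x₀ → 0 ≤ φ x) (hsc₂ : ∀ x : ℝ, x₀ ≤ x → φ x ≤ 0)
    (hpos : 0 ≤ ∫ x, φ x * g₂ x ∂μ) :
    0 ≤ ∫ x, φ x * g₁ x ∂μ := by
  calc 0 ≤ ρ x₀ * ∫ x, φ x * g₂ x ∂μ := mul_nonneg (hρ0 x₀) hpos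
    _ = ∫ x, ρ x₀ * (φ x * g₂ x) ∂μ := (integral_const_mul _ _).symm
    _ ≤ ∫ x, φ x * g₁ x ∂μ := by
      refine integral_mono (hint₂.const_mul (ρ x₀)) hint₁ fun x => ?_
      suffices h : 0 ≤ (ρ x - ρ x₀) * φ x * g₂ x by
        simp only [hratio]
        linarith
      refine mul_nonneg ?_ (hg₂ x)
      rcases le_total x x₀ with hx | hx
      · exact mul_nonneg (sub_nonneg.2 (hρ _ _ hx)) (hsc₁ x hx)
      · exact mul_nonneg_of_nonpos_of_nonpos (sub_nonpos.2 (hρ _ _ hx)) (hsc₂ x hx)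
end

section
/- Suppose the noise density f is log-concave, i.e., x ↦ f'(x)/f(x) is nonincreasing on (x̲, x̄), and let x_m ∈ [x̲, x̄] be a global maximizer of f. Then for every pay scheme w satisfying the anonymity, monotonicity, and budget conditions (a)–(c), and every e ∈ ℝ, R(e; w) ≤ f(x_m)·F(x_m)^{n−1} + (n−1)·∫_{x_m}^{x̄} F(x)^{n−2}·f(x)² dx. -/
open MeasureTheory

/-- A pay scheme for `n` players: measurable, anonymous, monotone in own output,
nonnegative, and respecting the unit prize budget. -/
def IsPayScheme (n : ℕ) (w : Fin n → (Fin n → ℝ) → ℝ) : Prop :=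
  (∀ i, Measurable (w i)) ∧
    (∀ (τ : Equiv.Perm (Fin n)) (i : Fin n) (y : Fin n → ℝ), w i y = w (τ i) (y ∘ τ.symm)) ∧
    (∀ (i : Fin n) (y y' : Fin n → ℝ), (∀ j, j ≠ i → y j = y' j) → y i ≤ y' i →
      w i y ≤ w i y') ∧
    (∀ i y, 0 ≤ w i y) ∧ (∀ y, ∑ i, w i y ≤ 1)

/-- The quantity `R(e; w)` from the proof of Proposition 4: with `n = m + 1` players,
`R(e;w) = -∫_{x_m}^{x̄} ∫_{ℝ^{n-1}} w_1(e+x_1, …, e+x_n) f'(x_1) f(x_2)⋯f(x_n) dx_2⋯dx_n dx_1`. -/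
noncomputable def Rfun (m : ℕ) (f f' : ℝ → ℝ) (xm : ℝ) (xu : EReal)
    (w : Fin (m + 1) → (Fin (m + 1) → ℝ) → ℝ) (e : ℝ) : ℝ :=
  - ∫ x₁ in {x : ℝ | xm < x ∧ (x : EReal) < xu},
      ∫ y : Fin m → ℝ,
        w 0 (Fin.cons (e + x₁) fun j => e + y j) * f' x₁ * ∏ j, f (y j)

open Filter Topology Set

/-- A player-indexed family of functions of the noise vector, invariant under relabelling, with
values in `[0, 1]`. -/
structure IsSymmetricFamily {ι : Type*} (v : ι → (ι → ℝ) → ℝ) : Prop where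
  measurable : ∀ i, Measurable (v i)
  symm : ∀ (τ : Equiv.Perm ι) (i : ι) (x : ι → ℝ), v i x = v (τ i) (x ∘ τ.symm)
  nonneg : ∀ i x, 0 ≤ v i x
  le_one : ∀ i x, v i x ≤ 1

namespace IsSymmetricFamily

variable {m : ℕ} {v : Fin (m + 1) → (Fin (m + 1) → ℝ) → ℝ} {A f : ℝ → ℝ}

theorem integrable_integral_zero (hv : IsSymmetricFamily v) (hf : Integrable f)
    (hA : Integrable fun x => A x * f x) :
    Integrable (fun x => v 0 x * (A (x 0) * ∏ j, f (x j))) ∧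
    ∫ x, v 0 x * (A (x 0) * ∏ j, f (x j)) =
      ∫ z, ∫ y : Fin m → ℝ, v 0 (Fin.cons z y) * ((A z * f z) * ∏ j, f (y j)) := by
  have hmp := (volume_preserving_piFinSuccAbove (fun _ : Fin (m + 1) => ℝ) 0).symm
  have hcons : ∀ p : ℝ × (Fin m → ℝ),
      (MeasurableEquiv.piFinSuccAbove (fun _ : Fin (m + 1) => ℝ) 0).symm p =
        Fin.cons p.1 p.2 := by
    intro p
    ext j
    simp [MeasurableEquiv.piFinSuccAbove, Fin.insertNthEquiv]
  have hmeas : Measurable fun p : ℝ × (Fin m → ℝ) => v 0 (Fin.cons p.1 p.2) := by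
    simpa only [Function.comp_def, hcons] using (hv.measurable 0).comp hmp.measurable
  have hprod : Integrable fun p : ℝ × (Fin m → ℝ) => (A p.1 * f p.1) * ∏ j, f (p.2 j) :=
    hA.mul_prod (g := fun y : Fin m → ℝ => ∏ j, f (y j)) (Integrable.fintype_prod fun _ => hf)
  have hint : Integrable fun p : ℝ × (Fin m → ℝ) =>
      v 0 (Fin.cons p.1 p.2) * ((A p.1 * f p.1) * ∏ j, f (p.2 j)) := by
    refine hprod.bdd_mul (c := 1) hmeas.aestronglyMeasurable (ae_of_all _ fun p => ?_)
    rw [Real.norm_eq_abs, abs_of_nonneg (hv.nonneg _ _)]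
    exact hv.le_one _ _
  have hcomp : ∀ p : ℝ × (Fin m → ℝ),
      (fun x => v 0 x * (A (x 0) * ∏ j, f (x j)))
        ((MeasurableEquiv.piFinSuccAbove (fun _ : Fin (m + 1) => ℝ) 0).symm p) =
      v 0 (Fin.cons p.1 p.2) * ((A p.1 * f p.1) * ∏ j, f (p.2 j)) := by
    intro p
    rw [hcons]
    simp [Fin.prod_univ_succ, mul_assoc]
  constructor
  · rw [← hmp.integrable_comp_emb (MeasurableEquiv.measurableEmbedding _)]
    exact hint.congr (ae_of_all _ fun p => (hcomp p).symm)
  · rw [← hmp.integral_comp', integral_congr_ae (ae_of_all _ hcomp)]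
    exact integral_prod _ hint

theorem integrable_integral_eq (hv : IsSymmetricFamily v) (hf : Integrable f)
    (hA : Integrable fun x => A x * f x) (i : Fin (m + 1)) :
    Integrable (fun x => v i x * (A (x i) * ∏ j, f (x j))) ∧
    ∫ x, v i x * (A (x i) * ∏ j, f (x j)) =
      ∫ x, v 0 x * (A (x 0) * ∏ j, f (x j)) := by
  set τ : Equiv.Perm (Fin (m + 1)) := Equiv.swap i 0
  have hmp := volume_measurePreserving_piCongrLeft (fun _ : Fin (m + 1) => ℝ) τ
  have happ : ∀ x : Fin (m + 1) → ℝ,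
      MeasurableEquiv.piCongrLeft (fun _ : Fin (m + 1) => ℝ) τ x = x ∘ τ.symm := by
    intro x
    ext j
    obtain ⟨k, rfl⟩ := τ.surjective j
    rw [MeasurableEquiv.coe_piCongrLeft, Equiv.piCongrLeft_apply_apply]
    simp
  have hcomp : ∀ x : Fin (m + 1) → ℝ,
      (fun x => v 0 x * (A (x 0) * ∏ j, f (x j)))
        (MeasurableEquiv.piCongrLeft (fun _ : Fin (m + 1) => ℝ) τ x) =
      v i x * (A (x i) * ∏ j, f (x j)) := by
    intro x
    have hi : τ i = 0 := Equiv.swap_apply_left i 0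
    have h0 : τ.symm 0 = i := by rw [← hi, Equiv.symm_apply_apply]
    have hp : ∏ j, f ((x ∘ τ.symm) j) = ∏ j, f (x j) :=
      Equiv.prod_comp τ.symm fun j => f (x j)
    rw [happ, hv.symm τ i x, hi]
    simp only [hp]
    simp only [Function.comp_apply, h0]
  constructor
  · have := (hv.integrable_integral_zero hf hA).1
    rw [← hmp.integrable_comp_emb (MeasurableEquiv.measurableEmbedding _)] at this
    exact this.congr (ae_of_all _ hcomp)
  · exact (integral_congr_ae (ae_of_all _ hcomp)).symm.trans 
      (hmp.integral_comp' fun x : Fin (m + 1) → ℝ => v 0 x * (A (x 0) * ∏ j, f (x j)))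

end IsSymmetricFamily

open Classical in
/-- The tournament awarding a unit prize to every player with the highest output. -/
noncomputable def topPrize {ι : Type*} (i : ι) (x : ι → ℝ) : ℝ :=
  if ∀ j, x j ≤ x i then 1 else 0

theorem isSymmetricFamily_topPrize {ι : Type*} [Countable ι] :
    IsSymmetricFamily (topPrize (ι := ι)) where
  measurable i := by
    classical
    refine Measurable.ite ?_ measurable_const measurable_const
    rw [ofPred_forall]
    exact MeasurableSet.iInter fun j =>
      measurableSet_le (measurable_pi_apply j) (measurable_pi_apply i)
  symm τ i x := by
    have : (∀ j, x j ≤ x i) ↔ ∀ j, (x ∘ τ.symm) j ≤ (x ∘ τ.symm) (τ i) := by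
      simp only [Function.comp_apply, Equiv.symm_apply_apply]
      exact ⟨fun h j => h _, fun h j => by simpa using h (τ j)⟩
    classical
    unfold topPrize
    exact if_congr this rfl rfl
  nonneg i x := by unfold topPrize; split_ifs <;> simp
  le_one i x := by unfold topPrize; split_ifs <;> simp

/-- Weights that are nondecreasing on the support make the top prize optimal. -/
theorem sum_mul_le_sum_topPrize_mul {ι : Type*} [Fintype ι] [Nonempty ι] {A f : ℝ → ℝ}
    (hf : ∀ z, 0 ≤ f z) (hA : ∀ z, 0 ≤ A z)
    (hmono : ∀ y z, y ≤ z → f z ≠ 0 → A y ≤ A z) {v : ι → ℝ} (hv : ∀ i, 0 ≤ v i)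
    (hsum : ∑ i, v i ≤ 1) (x : ι → ℝ) :
    ∑ i, v i * (A (x i) * ∏ j, f (x j)) ≤ ∑ i, topPrize i x * (A (x i) * ∏ j, f (x j)) := by
  by_cases hP : ∏ j, f (x j) = 0
  · simp [hP]
  have hP0 : 0 ≤ ∏ j, f (x j) := Finset.prod_nonneg fun j _ => hf _
  obtain ⟨k, hk⟩ := Finite.exists_max x
  have hfk : f (x k) ≠ 0 := fun h => hP (Finset.prod_eq_zero (Finset.mem_univ k) h)
  have htop : topPrize k x = 1 := by simp [topPrize, hk]
  have hnn : 0 ≤ A (x k) * ∏ j, f (x j) := mul_nonneg (hA _) hP0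
  calc ∑ i, v i * (A (x i) * ∏ j, f (x j))
      ≤ ∑ i, v i * (A (x k) * ∏ j, f (x j)) := by
        gcongr with i
        · exact hv i
        · exact hmono _ _ (hk i) hfk
    _ = (∑ i, v i) * (A (x k) * ∏ j, f (x j)) := (Finset.sum_mul _ _ _).symm
    _ ≤ topPrize k x * (A (x k) * ∏ j, f (x j)) := by
        rw [htop]; gcongr
    _ ≤ ∑ i, topPrize i x * (A (x i) * ∏ j, f (x j)) :=
        Finset.single_le_sum (f := fun i => topPrize i x * (A (x i) * ∏ j, f (x j)))
          (fun i _ => mul_nonneg (isSymmetricFamily_topPrize.nonneg i x)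
            (mul_nonneg (hA _) hP0)) (Finset.mem_univ k)

theorem integral_topPrize_cons_mul {f : ℝ → ℝ} (m : ℕ) (z c : ℝ) :
    ∫ y : Fin m → ℝ, topPrize 0 (Fin.cons z y : Fin (m + 1) → ℝ) * (c * ∏ j, f (y j)) =
      c * Fcdf f z ^ m := by
  have h : ∀ y : Fin m → ℝ, topPrize 0 (Fin.cons z y : Fin (m + 1) → ℝ) * (c * ∏ j, f (y j)) =
      c * ∏ j, (Iic z).indicator f (y j) := by
    intro y
    by_cases hy : ∀ j, y j ≤ z
    · simp [topPrize, Fin.forall_fin_succ, hy, indicator]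
    · have hy' := hy
      push Not at hy'
      obtain ⟨j, hj⟩ := hy'
      have h0 : (Iic z).indicator f (y j) = 0 := by simp [hj]
      rw [Finset.prod_eq_zero (f := fun j => (Iic z).indicator f (y j)) (Finset.mem_univ j) h0]
      simp [topPrize, Fin.forall_fin_succ, hy]
  rw [integral_congr_ae (ae_of_all _ h), integral_const_mul,
    integral_fintype_prod_volume_eq_pow ((Iic z).indicator f), Fintype.card_fin,
    integral_indicator measurableSet_Iic, Fcdf]

/-- Among symmetric schemes within a unit budget, the top prize maximises the expected weighted
reward when the weight is nondecreasing on the support. -/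
theorem integral_cons_le_of_monotone_weight {m : ℕ} {v : Fin (m + 1) → (Fin (m + 1) → ℝ) → ℝ}
    {A f : ℝ → ℝ} (hv : IsSymmetricFamily v) (hsum : ∀ x, ∑ i, v i x ≤ 1)
    (hfi : Integrable f) (hAi : Integrable fun x => A x * f x)
    (hf : ∀ z, 0 ≤ f z) (hA : ∀ z, 0 ≤ A z)
    (hmono : ∀ y z, y ≤ z → f z ≠ 0 → A y ≤ A z) :
    ∫ z, ∫ y : Fin m → ℝ, v 0 (Fin.cons z y) * ((A z * f z) * ∏ j, f (y j)) ≤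
      ∫ z, (A z * f z) * Fcdf f z ^ m := by
  have ht := isSymmetricFamily_topPrize (ι := Fin (m + 1))
  have key : ∑ i, ∫ x : Fin (m + 1) → ℝ, v i x * (A (x i) * ∏ j, f (x j)) ≤
      ∑ i, ∫ x : Fin (m + 1) → ℝ, topPrize i x * (A (x i) * ∏ j, f (x j)) := by
    rw [← integral_finsetSum _ fun i _ => (hv.integrable_integral_eq hfi hAi i).1,
      ← integral_finsetSum _ fun i _ => (ht.integrable_integral_eq hfi hAi i).1]
    refine integral_mono
      (integrable_finsetSum _ fun i _ => (hv.integrable_integral_eq hfi hAi i).1)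
      (integrable_finsetSum _ fun i _ => (ht.integrable_integral_eq hfi hAi i).1) fun x => ?_
    exact sum_mul_le_sum_topPrize_mul hf hA hmono (fun i => hv.nonneg i x) (hsum x) x
  simp only [fun i : Fin (m + 1) => (hv.integrable_integral_eq hfi hAi i).2,
    fun i : Fin (m + 1) => (ht.integrable_integral_eq hfi hAi i).2, Finset.sum_const, Finset.card_univ,
    Fintype.card_fin, nsmul_eq_mul, (hv.integrable_integral_zero hfi hAi).2,
    (ht.integrable_integral_zero hfi hAi).2, integral_topPrize_cons_mul] at key
  exact le_of_mul_le_mul_left key (by positivity)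

theorem tendsto_nhdsLT_of_comap_coe {G : ℝ → ℝ} {b : ℝ} {l : Filter ℝ}
    (h : Tendsto G (comap (fun x : ℝ => (x : EReal)) (𝓝[<] (b : EReal))) l) :
    Tendsto G (𝓝[<] b) l := by
  refine h.mono_left (Tendsto.le_comap (tendsto_nhdsWithin_iff.2 ⟨?_, ?_⟩))
  · exact (continuous_coe_real_ereal.tendsto b).mono_left nhdsWithin_le_nhds
  · filter_upwards [self_mem_nhdsWithin] with x hx
    exact EReal.coe_lt_coe_iff.2 hx

theorem tendsto_atTop_of_comap_coe {G : ℝ → ℝ} {l : Filter ℝ}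
    (h : Tendsto G (comap (fun x : ℝ => (x : EReal)) (𝓝[<] (⊤ : EReal))) l) :
    Tendsto G atTop l :=
  h.mono_left (Tendsto.le_comap (tendsto_nhdsWithin_iff.2
    ⟨EReal.tendsto_coe_nhds_top_iff.2 tendsto_id, .of_forall EReal.coe_lt_top⟩))

theorem setOf_lt_and_coe_lt_coe (a b : ℝ) :
    {x : ℝ | a < x ∧ (x : EReal) < (b : EReal)} = Ioo a b := by
  ext x
  simp

theorem setOf_lt_and_coe_lt_top (a : ℝ) : {x : ℝ | a < x ∧ (x : EReal) < ⊤} = Ioi a := by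
  ext x
  simp [EReal.coe_lt_top]

theorem measurableSet_lt_and_coe_lt (a : ℝ) (b : EReal) :
    MeasurableSet {x : ℝ | a < x ∧ (x : EReal) < b} :=
  (measurableSet_lt measurable_const measurable_id).inter
    (measurableSet_lt measurable_coe_real_ereal measurable_const)

theorem integrableOn_deriv_of_nonpos_of_tendsto_coe {g g' : ℝ → ℝ} {a l : ℝ} {b : EReal}
    (hab : (a : EReal) < b) (hc : ContinuousWithinAt g (Ici a) a)
    (hd : ∀ x, a < x → (x : EReal) < b → HasDerivAt g (g' x) x)
    (hneg : ∀ x, a < x → (x : EReal) < b → g' x ≤ 0)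
    (ht : Tendsto g (comap (fun x : ℝ => (x : EReal)) (𝓝[<] b)) (𝓝 l)) :
    IntegrableOn g' {x : ℝ | a < x ∧ (x : EReal) < b} := by
  induction b with
  | bot => simp at hab
  | top =>
    rw [setOf_lt_and_coe_lt_top]
    exact integrableOn_Ioi_deriv_of_nonpos hc (fun x hx => hd x hx (EReal.coe_lt_top x))
      (fun x hx => hneg x hx (EReal.coe_lt_top x)) (tendsto_atTop_of_comap_coe ht)
  | coe b =>
    have hab' : a < b := EReal.coe_lt_coe_iff.1 hab
    have hd' : ∀ x ∈ Ioo a b, HasDerivAt g (g' x) x :=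
      fun x hx => hd x hx.1 (EReal.coe_lt_coe_iff.2 hx.2)
    rw [setOf_lt_and_coe_lt_coe]
    have hcont : ContinuousOn (Function.update g b l) (Icc a b) := by
      rw [continuousOn_update_iff, Icc_sdiff_right]
      refine ⟨fun x hx => ?_, fun _ =>
        (tendsto_nhdsLT_of_comap_coe ht).mono_left (nhdsWithin_mono _ fun x hx => hx.2)⟩
      rcases hx.1.eq_or_lt with rfl | hax
      · exact hc.mono fun y hy => hy.1
      · exact (hd' x ⟨hax, hx.2⟩).continuousAt.continuousWithinAt
    have hderiv : ∀ x ∈ Ioo a b, HasDerivAt (Function.update g b l) (g' x) x := by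
      intro x hx
      refine (hd' x hx).congr_of_eventuallyEq ?_
      filter_upwards [isOpen_ne.mem_nhds hx.2.ne] with y hy
      exact Function.update_of_ne hy _ _
    have := intervalIntegral.integrableOn_deriv_of_nonneg (g' := fun x => -g' x) hcont.neg
      (fun x hx => (hderiv x hx).neg)
      (fun x hx => neg_nonneg.2 (hneg x hx.1 (EReal.coe_lt_coe_iff.2 hx.2)))
    simpa using (this.mono_set Ioo_subset_Ioc_self).neg

theorem integral_deriv_of_tendsto_coe {g g' : ℝ → ℝ} {a l : ℝ} {b : EReal}
    (hab : (a : EReal) < b) (hc : ContinuousWithinAt g (Ici a) a)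
    (hd : ∀ x, a < x → (x : EReal) < b → HasDerivAt g (g' x) x)
    (hint : IntegrableOn g' {x : ℝ | a < x ∧ (x : EReal) < b})
    (ht : Tendsto g (comap (fun x : ℝ => (x : EReal)) (𝓝[<] b)) (𝓝 l)) :
    ∫ x in {x : ℝ | a < x ∧ (x : EReal) < b}, g' x = l - g a := by
  induction b with
  | bot => simp at hab
  | top =>
    rw [setOf_lt_and_coe_lt_top] at hint ⊢
    exact integral_Ioi_of_hasDerivAt_of_tendsto hc (fun x hx => hd x hx (EReal.coe_lt_top x))
      hint (tendsto_atTop_of_comap_coe ht)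
  | coe b =>
    have hab' : a < b := EReal.coe_lt_coe_iff.1 hab
    rw [setOf_lt_and_coe_lt_coe] at hint ⊢
    rw [← integral_Ioc_eq_integral_Ioo, ← intervalIntegral.integral_of_le hab'.le]
    exact intervalIntegral.integral_eq_sub_of_hasDerivAt_of_tendsto hab'
      (fun x hx => hd x hx.1 (EReal.coe_lt_coe_iff.2 hx.2))
      ((intervalIntegrable_iff_integrableOn_Ioo_of_le hab'.le).2 hint)
      (hc.mono_left (nhdsWithin_mono _ Ioi_subset_Ici_self)) (tendsto_nhdsLT_of_comap_coe ht)

theorem Fcdf_nonneg {f : ℝ → ℝ} (hf : ∀ x, 0 ≤ f x) (x : ℝ) : 0 ≤ Fcdf f x :=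
  setIntegral_nonneg measurableSet_Iic fun u _ => hf u

theorem Fcdf_le_one {f : ℝ → ℝ} (hf : ∀ x, 0 ≤ f x) (hi : Integrable f) (h1 : ∫ x, f x = 1)
    (x : ℝ) : Fcdf f x ≤ 1 :=
  (setIntegral_le_integral hi (ae_of_all _ hf)).trans_eq h1

theorem Fcdf_eq_add_intervalIntegral {f : ℝ → ℝ} (hi : Integrable f) (a : ℝ) :
    Fcdf f = fun x => Fcdf f a + ∫ u in a..x, f u := by
  funext x
  rw [← intervalIntegral.integral_Iic_sub_Iic hi.integrableOn hi.integrableOn]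
  simp [Fcdf]

theorem continuous_Fcdf {f : ℝ → ℝ} (hi : Integrable f) : Continuous (Fcdf f) := by
  rw [Fcdf_eq_add_intervalIntegral hi 0]
  exact continuous_const.add
    (intervalIntegral.continuous_primitive (fun _ _ => hi.intervalIntegrable) 0)

theorem hasDerivAt_Fcdf {f : ℝ → ℝ} (hi : Integrable f) {x : ℝ} (hx : ContinuousAt f x) :
    HasDerivAt (Fcdf f) (f x) x := by
  rw [Fcdf_eq_add_intervalIntegral hi 0]
  exact (intervalIntegral.integral_hasDerivAt_right hi.intervalIntegrable
    (hi.aestronglyMeasurable.stronglyMeasurableAtFilter) hx).const_add _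

theorem eq_zero_of_upper_le {f : ℝ → ℝ} {xl xu : EReal} (hlt : xl < xu)
    (hzero : ∀ x : ℝ, xu < (x : EReal) → f x = 0)
    (hcont : ContinuousOn f {x : ℝ | xl ≤ (x : EReal) ∧ (x : EReal) ≤ xu})
    (htail : Tendsto f (comap (fun x : ℝ => (x : EReal)) (𝓝[<] xu)) (𝓝 0))
    {x : ℝ} (hx : xu ≤ (x : EReal)) : f x = 0 := by
  rcases hx.lt_or_eq with hx | rfl
  · exact hzero x hx
  have hc : ContinuousWithinAt f _ x := hcont x ⟨hlt.le, le_rfl⟩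
  refine tendsto_nhds_unique (hc.mono_left (nhdsWithin_le_iff.2 ?_))
    (tendsto_nhdsLT_of_comap_coe htail)
  have hopen : {y : ℝ | xl < (y : EReal)} ∈ 𝓝 x :=
    (isOpen_Ioi.preimage continuous_coe_real_ereal).mem_nhds hlt
  filter_upwards [self_mem_nhdsWithin, mem_nhdsWithin_of_mem_nhds hopen] with y hy hy'
  exact ⟨le_of_lt hy', EReal.coe_le_coe_iff.2 (le_of_lt hy)⟩

/-- A density that vanishes outside an interval, is positive inside and continuous up to the
boundary is nonnegative. -/
theorem nonneg_of_pos_on_interior {f : ℝ → ℝ} {xl xu : EReal} (hlt : xl < xu)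
    (hpos : ∀ x : ℝ, xl < (x : EReal) → (x : EReal) < xu → 0 < f x)
    (hzero : ∀ x : ℝ, (x : EReal) < xl → f x = 0)
    (hupper : ∀ x : ℝ, xu ≤ (x : EReal) → f x = 0)
    (hcont : ContinuousOn f {x : ℝ | xl ≤ (x : EReal) ∧ (x : EReal) ≤ xu}) (x : ℝ) :
    0 ≤ f x := by
  rcases le_or_gt xu (x : EReal) with hu | hu
  · exact (hupper x hu).ge
  rcases lt_trichotomy xl (x : EReal) with hl | rfl | hl
  · exact (hpos x hl hu).le
  · have hc : ContinuousWithinAt f _ x := hcont x ⟨le_rfl, hlt.le⟩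
    have hopen : {y : ℝ | (y : EReal) < xu} ∈ 𝓝 x :=
      (isOpen_Iio.preimage continuous_coe_real_ereal).mem_nhds hu
    have hev : ∀ᶠ y in 𝓝[>] x, x < y ∧ (y : EReal) < xu := by
      filter_upwards [self_mem_nhdsWithin, mem_nhdsWithin_of_mem_nhds hopen] with y hy hy'
      exact ⟨hy, hy'⟩
    refine ge_of_tendsto (hc.mono_left (nhdsWithin_le_iff.2 ?_)) (hev.mono fun y hy =>
      (hpos y (EReal.coe_lt_coe_iff.2 hy.1) hy.2).le)
    exact hev.mono fun y hy => ⟨EReal.coe_le_coe_iff.2 hy.1.le, hy.2.le⟩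
  · exact (hzero x hl).ge

/-- For a log-concave noise density `f` with global maximizer `xm`, every
anonymous, monotone, budget-feasible pay scheme `w` satisfies, for `n = m + 1` players,
`R(e; w) ≤ f(x_m) F(x_m)^{n-1} + (n-1) ∫_{x_m}^{x̄} F(x)^{n-2} f(x)² dx`. -/
theorem stmt13 (m : ℕ) (hm : 1 ≤ m) (f f' : ℝ → ℝ) (xl xu : EReal) (hlt : xl < xu)
    (hpos : ∀ x : ℝ, xl < (x : EReal) → (x : EReal) < xu → 0 < f x)
    (hzero : ∀ x : ℝ, ((x : EReal) < xl ∨ xu < (x : EReal)) → f x = 0)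
    (hcont : ContinuousOn f {x : ℝ | xl ≤ (x : EReal) ∧ (x : EReal) ≤ xu})
    (hderiv : ∀ x : ℝ, xl < (x : EReal) → (x : EReal) < xu → HasDerivAt f (f' x) x)
    (hint : ∫ x, f x = 1)
    (htail : Filter.Tendsto f
      (Filter.comap (fun x : ℝ => (x : EReal)) (nhdsWithin xu (Set.Iio xu))) (nhds 0))
    (hlogconcave : ∀ x y : ℝ, xl < (x : EReal) → x ≤ y → (y : EReal) < xu →
      f' y / f y ≤ f' x / f x)
    (xm : ℝ) (hxm₁ : xl ≤ (xm : EReal)) (hxm₂ : (xm : EReal) ≤ xu)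
    (hmax : ∀ x, f x ≤ f xm)
    (w : Fin (m + 1) → (Fin (m + 1) → ℝ) → ℝ) (hw : IsPayScheme (m + 1) w) (e : ℝ) :
    Rfun m f f' xm xu w e ≤
      f xm * Fcdf f xm ^ m +
        (m : ℝ) * ∫ x in {x : ℝ | xm < x ∧ (x : EReal) < xu}, Fcdf f x ^ (m - 1) * f x ^ 2 := by
  have hi : Integrable f := by
    by_contra h
    simp [integral_undef h] at hint
  have hupper : ∀ x : ℝ, xu ≤ (x : EReal) → f x = 0 := fun x hx =>
    eq_zero_of_upper_le hlt (fun x hx => hzero x (.inr hx)) hcont htail hx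
  have hnn : ∀ x, 0 ≤ f x :=
    nonneg_of_pos_on_interior hlt hpos (fun x hx => hzero x (.inl hx)) hupper hcont
  have hxmu : (xm : EReal) < xu := by
    by_contra h
    have h0 := hupper xm (not_lt.1 h)
    have : f = 0 := funext fun x => le_antisymm ((hmax x).trans_eq h0) (hnn x)
    simp [this] at hint
  have hxl : ∀ {x : ℝ}, xm < x → xl < (x : EReal) := fun hx =>
    hxm₁.trans_lt (EReal.coe_lt_coe_iff.2 hx)
  set S : Set ℝ := {x : ℝ | xm < x ∧ (x : EReal) < xu} with hS
  have hSm : MeasurableSet S := measurableSet_lt_and_coe_lt xm xu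
  have hcm : ContinuousWithinAt f (Ici xm) xm := by
    refine ContinuousWithinAt.mono_of_mem_nhdsWithin (hcont xm ⟨hxm₁, hxm₂⟩) ?_
    have hopen : {y : ℝ | (y : EReal) < xu} ∈ 𝓝 xm :=
      (isOpen_Iio.preimage continuous_coe_real_ereal).mem_nhds hxmu
    filter_upwards [self_mem_nhdsWithin, mem_nhdsWithin_of_mem_nhds hopen] with y hy hy'
    exact ⟨hxm₁.trans (EReal.coe_le_coe_iff.2 hy), le_of_lt hy'⟩
  have hd : ∀ x, xm < x → (x : EReal) < xu → HasDerivAt f (f' x) x := fun x hx hx' =>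
    hderiv x (hxl hx) hx'
  have hf'neg : ∀ x, xm < x → (x : EReal) < xu → f' x ≤ 0 := by
    intro x hx hxu
    by_contra! hpos'
    have hlt' : ∀ y : ℝ, y ≤ x → (y : EReal) < xu := fun y hy =>
      (EReal.coe_le_coe_iff.2 hy).trans_lt hxu
    have hmono : StrictMonoOn f (Icc xm x) := by
      refine strictMonoOn_of_deriv_pos (convex_Icc _ _) (fun y hy => ?_) fun y hy => ?_
      · rcases hy.1.eq_or_lt with rfl | h
        · exact hcm.mono fun z hz => hz.1
        · exact (hd y h (hlt' y hy.2)).continuousAt.continuousWithinAt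
      · rw [interior_Icc] at hy
        have hyu := hlt' y hy.2.le
        rw [(hd y hy.1 hyu).deriv]
        have h1 := hlogconcave y x (hxl hy.1) hy.2.le hxu
        have h2 : 0 < f' y / f y := (div_pos hpos' (hpos x (hxl hx) hxu)).trans_le h1
        exact (div_pos_iff_of_pos_right (hpos y (hxl hy.1) hyu)).1 h2
    exact (hmax x).not_gt (hmono (left_mem_Icc.2 hx.le) (right_mem_Icc.2 hx.le) hx)
  have hf'i : IntegrableOn f' S :=
    integrableOn_deriv_of_nonpos_of_tendsto_coe hxmu hcm hd hf'neg htail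
  have hFc := continuous_Fcdf hi
  have hF0 := Fcdf_nonneg hnn
  have hF1 := Fcdf_le_one hnn hi hint
  have hFb : ∀ k x, ‖Fcdf f x ^ k‖ ≤ 1 := fun k x => by
    rw [Real.norm_of_nonneg (pow_nonneg (hF0 x) k)]
    exact pow_le_one₀ (hF0 x) (hF1 x)
  have hI1 : IntegrableOn (fun x => Fcdf f x ^ m * f' x) S :=
    hf'i.bdd_mul (c := 1) (hFc.pow m).aestronglyMeasurable (ae_of_all _ (hFb m))
  have hI2 : IntegrableOn (fun x => Fcdf f x ^ (m - 1) * f x ^ 2) S := by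
    refine Integrable.bdd_mul (c := 1) (Integrable.integrableOn ?_)
      (hFc.pow _).aestronglyMeasurable (ae_of_all _ (hFb _))
    simp only [pow_two]
    refine hi.bdd_mul (c := f xm) hi.aestronglyMeasurable (ae_of_all _ fun x => ?_)
    rw [Real.norm_of_nonneg (hnn x)]
    exact hmax x
  have hparts : ∫ x in S, (Fcdf f x ^ m * f' x + m * (Fcdf f x ^ (m - 1) * f x ^ 2)) =
      0 - Fcdf f xm ^ m * f xm := by
    refine integral_deriv_of_tendsto_coe (g := fun x => Fcdf f x ^ m * f x) hxmu
      ((hFc.pow m).continuousWithinAt.mul hcm) (fun x hx hxu => ?_)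
      (hI1.add (hI2.const_mul _)) ?_
    · have hdx := hd x hx hxu
      refine (((hasDerivAt_Fcdf hi hdx.continuousAt).pow m).mul hdx).congr_deriv ?_
      simp only [Pi.pow_apply]
      ring
    · exact squeeze_zero (fun x => mul_nonneg (pow_nonneg (hF0 x) m) (hnn x))
        (fun x => mul_le_of_le_one_left (hnn x) (pow_le_one₀ (hF0 x) (hF1 x))) htail
  rw [integral_add hI1 (hI2.const_mul _), integral_const_mul] at hparts
  set A : ℝ → ℝ := S.indicator fun x => -(f' x / f x)
  have hAf : ∀ z, A z * f z = S.indicator (fun x => -f' x) z := by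
    intro z
    by_cases hz : z ∈ S
    · have := (hpos z (hxl hz.1) hz.2).ne'
      simp only [A, indicator_of_mem hz]
      field_simp
    · simp [A, hz]
  have hA0 : ∀ z, 0 ≤ A z := fun z => indicator_nonneg (fun x hx =>
    neg_nonneg.2 (div_nonpos_of_nonpos_of_nonneg (hf'neg x hx.1 hx.2) (hnn x))) z
  have hAmono : ∀ y z, y ≤ z → f z ≠ 0 → A y ≤ A z := by
    intro y z hyz hz
    by_cases hy : y ∈ S
    · have hzS : z ∈ S := ⟨hy.1.trans_le hyz, not_le.1 fun h => hz (hupper z h)⟩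
      simp only [A, indicator_of_mem hy, indicator_of_mem hzS]
      exact neg_le_neg (hlogconcave y z (hxl hy.1) hyz hzS.2)
    · simpa [A, hy] using hA0 z
  have hAi : Integrable fun x => A x * f x := by
    simp only [hAf]
    exact hf'i.neg.integrable_indicator hSm
  obtain ⟨hwm, hws, -, hw0, hw1⟩ := hw
  have hv : IsSymmetricFamily fun i x => w i fun j => e + x j :=
    { measurable := fun i => (hwm i).comp (by fun_prop)
      symm := fun τ i x => hws τ i _
      nonneg := fun i x => hw0 i _
      le_one := fun i x => (Finset.single_le_sum (fun i _ => hw0 i _) (Finset.mem_univ i)).trans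
        (hw1 _) }
  have key := integral_cons_le_of_monotone_weight hv (fun x => hw1 _) hi hAi hnn hA0 hAmono
  have hL : Rfun m f f' xm xu w e = ∫ z, ∫ y : Fin m → ℝ,
      w 0 (fun j => e + (Fin.cons z y : Fin (m + 1) → ℝ) j) * ((A z * f z) * ∏ j, f (y j)) := by
    rw [Rfun, ← integral_neg, ← integral_indicator hSm]
    congr 1
    funext z
    by_cases hz : z ∈ S
    · rw [indicator_of_mem hz, hAf, indicator_of_mem hz, ← integral_neg]
      congr 1
      funext y
      have : (fun j => e + (Fin.cons z y : Fin (m + 1) → ℝ) j) =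
          Fin.cons (e + z) fun j => e + y j := by
        funext j
        refine Fin.cases ?_ (fun j => ?_) j <;> simp
      rw [this]
      ring
    · simp [hAf, hz]
  have hR : ∫ z, (A z * f z) * Fcdf f z ^ m = -∫ x in S, Fcdf f x ^ m * f' x := by
    rw [← integral_neg, ← integral_indicator hSm]
    congr 1
    funext z
    by_cases hz : z ∈ S
    · rw [hAf, indicator_of_mem hz, indicator_of_mem hz]
      ring
    · simp [hAf, hz]
  rw [hL]
  linarith
end

section
/- Suppose the noise density f is log-convex, i.e., x ↦ f'(x)/f(x) is nondecreasing on (x̲, x̄), the lower endpoint x̲ is finite, and f(x) → 0 as x → x̄ (so that f is nonincreasing on the support and its mode is x̲; write f(x̲) for the right limit of f at x̲). Then, taking x_m = x̲ in the definition of R, for every pay scheme w satisfying the anonymity, monotonicity, and budget conditions (a)–(c), and every e ∈ ℝ, R(e; w) ≤ f(x̲)/n. -/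
open MeasureTheory

open Set Filter Topology in
/-- Chebyshev's association inequality: for a probability density `p` on `S`, a bounded monotone
`h` and an antitone `g` are negatively correlated. -/
theorem setIntegral_mul_le_of_monotoneOn_of_antitoneOn {α : Type*} [LinearOrder α]
    [MeasurableSpace α] {μ : Measure α} {S : Set α} (hS : MeasurableSet S) {p g h : α → ℝ}
    (hp0 : ∀ x ∈ S, 0 ≤ p x) (hp : IntegrableOn p S μ) (hp1 : ∫ x in S, p x ∂μ = 1)
    (hgp : IntegrableOn (fun x => g x * p x) S μ) (hg : AntitoneOn g S)
    (hh : MonotoneOn h S) (hhm : AEStronglyMeasurable h (μ.restrict S))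
    (h0 : ∀ x, 0 ≤ h x) (h1 : ∀ x, h x ≤ 1) :
    ∫ x in S, h x * (g x * p x) ∂μ ≤
      (∫ x in S, h x * p x ∂μ) * ∫ x in S, g x * p x ∂μ := by
  have hb : ∀ᵐ x ∂μ.restrict S, ‖h x‖ ≤ 1 := ae_of_all _ fun x => by
    rw [Real.norm_eq_abs, abs_of_nonneg (h0 x)]; exact h1 x
  have i1 : IntegrableOn (fun x => h x * p x) S μ := hp.bdd_mul hhm hb
  have i2 : IntegrableOn (fun x => h x * (g x * p x)) S μ := hgp.bdd_mul hhm hb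
  set c := ∫ x in S, g x * p x ∂μ with hc
  set A := h '' {x ∈ S | c < g x} with hA
  have hAb : BddAbove A := ⟨1, by rintro _ ⟨x, _, rfl⟩; exact h1 x⟩
  have key : ∀ x ∈ S, h x * (g x * p x) ≤
      c * (h x * p x) + sSup A * (g x * p x - c * p x) := by
    intro x hx
    have hsign : (h x - sSup A) * (g x - c) ≤ 0 := by
      rcases lt_or_ge c (g x) with hcx | hcx
      · have : h x ≤ sSup A := le_csSup hAb ⟨x, ⟨hx, hcx⟩, rfl⟩
        exact mul_nonpos_of_nonpos_of_nonneg (by linarith) (by linarith)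
      · have : sSup A ≤ h x := by
          refine Real.sSup_le ?_ (h0 x)
          rintro _ ⟨z, ⟨hz, hcz⟩, rfl⟩
          refine hh hz hx (le_of_not_ge fun hxz => ?_)
          exact absurd (hg hx hz hxz) (not_le.2 (hcx.trans_lt hcz))
        exact mul_nonpos_of_nonneg_of_nonpos (by linarith) (by linarith)
    nlinarith [mul_nonneg (neg_nonneg.2 hsign) (hp0 x hx)]
  have i3 : IntegrableOn (fun x => g x * p x - c * p x) S μ := hgp.sub (hp.const_mul c)
  calc ∫ x in S, h x * (g x * p x) ∂μ
      ≤ ∫ x in S, (c * (h x * p x) + sSup A * (g x * p x - c * p x)) ∂μ :=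
        setIntegral_mono_on i2 ((i1.const_mul c).add (i3.const_mul _)) hS key
    _ = (∫ x in S, h x * p x ∂μ) * c := by
        rw [integral_add (i1.const_mul c) (i3.const_mul _), integral_const_mul,
          integral_const_mul, integral_sub hgp (hp.const_mul c), integral_const_mul, hp1, ← hc]
        ring

/-- By symmetry, a player in an anonymous pay scheme facing exchangeable shocks receives at most
an equal share of the budget in expectation. -/
theorem IsPayScheme.integral_le_inv {m : ℕ} {f : ℝ → ℝ} (hf0 : ∀ᵐ x, 0 ≤ f x)
    (hf : Integrable f) (hf1 : ∫ x, f x = 1) {w : Fin (m + 1) → (Fin (m + 1) → ℝ) → ℝ}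
    (hw : IsPayScheme (m + 1) w) (e : ℝ) :
    ∫ z : Fin (m + 1) → ℝ, w 0 (fun j => e + z j) * ∏ j, f (z j) ≤ 1 / (m + 1 : ℝ) := by
  obtain ⟨hmeas, hanon, -, hnn, hbud⟩ := hw
  have hP : Integrable (fun z : Fin (m + 1) → ℝ => ∏ j, f (z j)) :=
    Integrable.fintype_prod (f := fun _ => f) fun _ => hf
  have hP0 : ∀ᵐ z : Fin (m + 1) → ℝ, 0 ≤ ∏ j, f (z j) := by
    have : ∀ᵐ z : Fin (m + 1) → ℝ, ∀ j, 0 ≤ f (z j) := ae_all_iff.2 fun j =>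
      (Measure.quasiMeasurePreserving_eval (fun _ : Fin (m + 1) => (volume : Measure ℝ)) j).ae hf0
    filter_upwards [this] with z hz using Finset.prod_nonneg fun j _ => hz j
  have hle1 : ∀ i y, w i y ≤ 1 := fun i y =>
    (Finset.single_le_sum (fun k _ => hnn k y) (Finset.mem_univ i)).trans (hbud y)
  have hshift : Measurable fun z : Fin (m + 1) → ℝ => fun j => e + z j := by fun_prop
  have hI : ∀ i, Integrable fun z : Fin (m + 1) → ℝ => w i (fun j => e + z j) * ∏ j, f (z j) :=
    fun i => hP.bdd_mul (c := 1) ((hmeas i).comp hshift).aestronglyMeasurable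
      (ae_of_all _ fun z => by
        rw [Real.norm_eq_abs, abs_of_nonneg (hnn _ _)]; exact hle1 _ _)
  have hsym : ∀ i, ∫ z : Fin (m + 1) → ℝ, w i (fun j => e + z j) * ∏ j, f (z j) =
      ∫ z : Fin (m + 1) → ℝ, w 0 (fun j => e + z j) * ∏ j, f (z j) := by
    intro i
    have hmp := volume_preserving_arrowCongr' (Equiv.swap i 0) (MeasurableEquiv.refl ℝ)
      (MeasurePreserving.id volume)
    rw [← hmp.integral_comp']
    refine integral_congr_ae (ae_of_all _ fun z => ?_)
    have hz : ∀ j, (MeasurableEquiv.arrowCongr' (Equiv.swap i 0) (MeasurableEquiv.refl ℝ)) z j =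
        z ((Equiv.swap i 0).symm j) := fun j => rfl
    simp only [hz]
    rw [hanon (Equiv.swap i 0) i, Equiv.swap_apply_left,
      Equiv.prod_comp (Equiv.swap i 0).symm fun j => f (z j)]
    simp [Function.comp_def]
  have hsum : ∑ i, ∫ z : Fin (m + 1) → ℝ, w i (fun j => e + z j) * ∏ j, f (z j) ≤ 1 := by
    rw [← integral_finsetSum _ fun i _ => hI i]
    calc _ ≤ ∫ z : Fin (m + 1) → ℝ, ∏ j, f (z j) := by
          refine integral_mono_ae (integrable_finsetSum _ fun i _ => hI i) hP ?_
          filter_upwards [hP0] with z hz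
          rw [← Finset.sum_mul]
          exact mul_le_of_le_one_left hz (hbud _)
      _ = 1 := by
          rw [integral_fintype_prod_volume_eq_pow, hf1, one_pow]
  simp only [hsym, Finset.sum_const, Finset.card_univ, Fintype.card_fin, nsmul_eq_mul] at hsum
  rw [le_div_iff₀ (by positivity), mul_comm]
  exact_mod_cast hsum

open Set Filter Topology in
/-- A log-convex density that vanishes at the upper endpoint of its support has a nonpositive
derivative, whose integral over the support is minus the value at the lower endpoint. -/
theorem deriv_nonpos_and_integral_of_logConvex {f f' : ℝ → ℝ} {xl : ℝ} {xu : EReal}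
    (hlt : (xl : EReal) < xu)
    (hpos : ∀ x : ℝ, (xl : EReal) < (x : EReal) → (x : EReal) < xu → 0 < f x)
    (hcont : ContinuousOn f {x : ℝ | (xl : EReal) ≤ (x : EReal) ∧ (x : EReal) ≤ xu})
    (hderiv : ∀ x : ℝ, (xl : EReal) < (x : EReal) → (x : EReal) < xu → HasDerivAt f (f' x) x)
    (htail : Tendsto f (comap (fun x : ℝ => (x : EReal)) (𝓝[<] xu)) (𝓝 0))
    (hlogconvex : ∀ x y : ℝ, (xl : EReal) < (x : EReal) → x ≤ y → (y : EReal) < xu →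
      f' x / f x ≤ f' y / f y) :
    (∀ x ∈ {x : ℝ | xl < x ∧ (x : EReal) < xu}, f' x ≤ 0) ∧
      IntegrableOn f' {x : ℝ | xl < x ∧ (x : EReal) < xu} ∧
      ∫ x in {x : ℝ | xl < x ∧ (x : EReal) < xu}, f' x = - f xl := by
  have sign : ∀ L : Filter ℝ, L.NeBot → Tendsto f L (𝓝 0) →
      (∀ x : ℝ, (x : EReal) < xu → ∀ᶠ y in L, x < y ∧ (y : EReal) < xu) →
      ∀ x ∈ {x : ℝ | xl < x ∧ (x : EReal) < xu}, f' x ≤ 0 := by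
    intro L hL hfL hev x ⟨hx, hxu⟩
    by_contra! hfx
    have hxl : (xl : EReal) < x := EReal.coe_lt_coe_iff.2 hx
    have hpx := hpos x hxl hxu
    have hD : Convex ℝ {y : ℝ | x ≤ y ∧ (y : EReal) < xu} := by
      refine OrdConnected.convex ⟨fun a ha b hb c hc => ⟨ha.1.trans hc.1, ?_⟩⟩
      exact (EReal.coe_le_coe_iff.2 hc.2).trans_lt hb.2
    have hd : ∀ y ∈ {y : ℝ | x ≤ y ∧ (y : EReal) < xu}, HasDerivAt f (f' y) y := fun y hy =>
      hderiv y (EReal.coe_lt_coe_iff.2 (hx.trans_le hy.1)) hy.2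
    have hmono : MonotoneOn f {y : ℝ | x ≤ y ∧ (y : EReal) < xu} := by
      refine monotoneOn_of_deriv_nonneg hD
        (fun y hy => (hd y hy).continuousAt.continuousWithinAt)
        (fun y hy => (hd y (interior_subset hy)).differentiableAt.differentiableWithinAt)
        fun y hy => ?_
      have hy := interior_subset hy
      rw [(hd y hy).deriv]
      have h1 : 0 < f' y / f y := (div_pos hfx hpx).trans_le (hlogconvex x y hxl hy.1 hy.2)
      have hpy := hpos y (EReal.coe_lt_coe_iff.2 (hx.trans_le hy.1)) hy.2
      exact ((div_pos_iff_of_pos_right hpy).1 h1).le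
    have : f x ≤ 0 := ge_of_tendsto hfL <| (hev x hxu).mono fun y hy =>
      hmono ⟨le_rfl, hxu⟩ ⟨hy.1.le, hy.2⟩ hy.1.le
    linarith
  induction xu with
  | bot => exact absurd hlt not_lt_bot
  | top =>
    have hS : {x : ℝ | xl < x ∧ (x : EReal) < ⊤} = Ioi xl := by
      ext x; simp [EReal.coe_lt_top]
    have hT : Tendsto f atTop (𝓝 0) := htail.mono_left <| by
      rw [← map_le_iff_le_comap]
      exact tendsto_nhdsWithin_iff.2 ⟨EReal.tendsto_coe_nhds_top_iff.2 tendsto_id,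
        Eventually.of_forall fun x => EReal.coe_lt_top x⟩
    have hneg := sign atTop inferInstance hT fun x _ =>
      (eventually_gt_atTop x).mono fun y hy => ⟨hy, EReal.coe_lt_top y⟩
    rw [hS] at hneg ⊢
    have hc : ContinuousWithinAt f (Ici xl) xl :=
      (hcont xl ⟨le_rfl, hlt.le⟩).mono fun x hx => ⟨EReal.coe_le_coe_iff.2 hx, le_top⟩
    have hd : ∀ x ∈ Ioi xl, HasDerivAt f (f' x) x := fun x hx =>
      hderiv x (EReal.coe_lt_coe_iff.2 hx) (EReal.coe_lt_top x)
    refine ⟨hneg, integrableOn_Ioi_deriv_of_nonpos hc hd hneg hT, ?_⟩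
    rw [integral_Ioi_of_hasDerivAt_of_nonpos hc hd hneg hT, zero_sub]
  | coe b =>
    have hlb : xl < b := EReal.coe_lt_coe_iff.1 hlt
    have hS : {x : ℝ | xl < x ∧ (x : EReal) < b} = Ioo xl b := by
      ext x; simp
    have hS' : {x : ℝ | (xl : EReal) ≤ (x : EReal) ∧ (x : EReal) ≤ b} = Icc xl b := by
      ext x; simp
    rw [hS'] at hcont
    have hT : Tendsto f (𝓝[<] b) (𝓝 0) := htail.mono_left <| by
      rw [← map_le_iff_le_comap]
      refine tendsto_nhdsWithin_iff.2 ⟨(continuous_coe_real_ereal.tendsto b).mono_left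
        nhdsWithin_le_nhds, ?_⟩
      filter_upwards [self_mem_nhdsWithin] with x hx using EReal.coe_lt_coe_iff.2 hx
    have hneg := sign (𝓝[<] b) inferInstance hT fun x hx => by
      filter_upwards [Ioo_mem_nhdsLT (EReal.coe_lt_coe_iff.1 hx)] with y hy using
        ⟨hy.1, EReal.coe_lt_coe_iff.2 hy.2⟩
    have hfb : f b = 0 := by
      have h1 : Tendsto f (𝓝[Ioo xl b] b) (𝓝 (f b)) :=
        (hcont b ⟨hlb.le, le_rfl⟩).mono Ioo_subset_Icc_self
      rw [nhdsWithin_Ioo_eq_nhdsLT hlb] at h1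
      exact tendsto_nhds_unique h1 hT
    rw [hS] at hneg ⊢
    have hd : ∀ x ∈ Ioo xl b, HasDerivAt f (f' x) x := fun x hx =>
      hderiv x (EReal.coe_lt_coe_iff.2 hx.1) (EReal.coe_lt_coe_iff.2 hx.2)
    have hi : IntegrableOn f' (Ioc xl b) := by
      have := intervalIntegral.integrableOn_deriv_of_nonneg hcont.neg
        (fun x hx => (hd x hx).neg) fun x hx => neg_nonneg.2 (hneg x hx)
      exact integrable_neg_iff.1 this
    refine ⟨hneg, hi.mono_set Ioo_subset_Ioc_self, ?_⟩
    rw [← integral_Ioc_eq_integral_Ioo, ← intervalIntegral.integral_of_le hlb.le,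
      intervalIntegral.integral_eq_sub_of_hasDerivAt_of_le hlb.le hcont hd
        ((intervalIntegrable_iff_integrableOn_Ioc_of_le hlb.le).2 hi), hfb, zero_sub]

/-- For a log-convex noise density `f` with finite lower endpoint `x̲` (so
that `f` is nonincreasing on the support and its mode is `x̲`), every anonymous, monotone,
budget-feasible pay scheme `w` satisfies, for `n = m + 1` players and `x_m = x̲`,
`R(e; w) ≤ f(x̲)/n`. -/
theorem stmt14 (m : ℕ) (hm : 1 ≤ m) (f f' : ℝ → ℝ) (xl : ℝ) (xu : EReal)
    (hlt : (xl : EReal) < xu)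
    (hpos : ∀ x : ℝ, (xl : EReal) < (x : EReal) → (x : EReal) < xu → 0 < f x)
    (hzero : ∀ x : ℝ, ((x : EReal) < (xl : EReal) ∨ xu < (x : EReal)) → f x = 0)
    (hcont : ContinuousOn f {x : ℝ | (xl : EReal) ≤ (x : EReal) ∧ (x : EReal) ≤ xu})
    (hderiv : ∀ x : ℝ, (xl : EReal) < (x : EReal) → (x : EReal) < xu → HasDerivAt f (f' x) x)
    (hint : ∫ x, f x = 1)
    (htail : Filter.Tendsto f
      (Filter.comap (fun x : ℝ => (x : EReal)) (nhdsWithin xu (Set.Iio xu))) (nhds 0))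
    (hlogconvex : ∀ x y : ℝ, (xl : EReal) < (x : EReal) → x ≤ y → (y : EReal) < xu →
      f' x / f x ≤ f' y / f y)
    (w : Fin (m + 1) → (Fin (m + 1) → ℝ) → ℝ) (hw : IsPayScheme (m + 1) w) (e : ℝ) :
    Rfun m f f' xl xu w e ≤ f xl / (m + 1 : ℝ) := by
  set S : Set ℝ := {x : ℝ | xl < x ∧ (x : EReal) < xu}
  have hS : MeasurableSet S := by
    refine MeasurableSet.inter measurableSet_Ioi ?_
    exact measurableSet_lt measurable_coe_real_ereal measurable_const
  obtain ⟨hneg, hf'int, hf'S⟩ : (∀ x ∈ S, f' x ≤ 0) ∧ IntegrableOn f' S ∧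
      ∫ x in S, f' x = -f xl :=
    deriv_nonpos_and_integral_of_logConvex hlt hpos hcont hderiv htail hlogconvex
  have hposS : ∀ x ∈ S, 0 < f x := fun x hx => hpos x (EReal.coe_lt_coe_iff.2 hx.1) hx.2
  have hfi : Integrable f := by
    by_contra h
    rw [integral_undef h] at hint
    exact zero_ne_one hint
  have hnull : ∀ᵐ x : ℝ, x ∉ S → f x = 0 := by
    have : ∀ᵐ x : ℝ, x ∉ ({xl, xu.toReal} : Set ℝ) :=
      compl_mem_ae_iff.2 ((Set.toFinite _).measure_zero volume)
    filter_upwards [this] with x hx hxS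
    simp only [Set.mem_insert_iff, Set.mem_singleton_iff, not_or] at hx
    refine hzero x ?_
    rcases lt_or_ge xl x with h | h
    · right
      refine lt_of_le_of_ne (not_lt.1 fun h' => hxS ⟨h, h'⟩) fun h' => hx.2 ?_
      rw [h', EReal.toReal_coe]
    · exact Or.inl (EReal.coe_lt_coe_iff.2 (lt_of_le_of_ne h hx.1))
  have hf0 : ∀ᵐ x, 0 ≤ f x := by
    filter_upwards [hnull] with x hx
    by_cases h : x ∈ S
    · exact (hposS x h).le
    · exact (hx h).ge
  have hset : ∀ h : ℝ → ℝ, ∫ x in S, h x * f x = ∫ x, h x * f x := fun h =>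
    setIntegral_eq_integral_of_ae_compl_eq_zero <| hnull.mono fun x hx hxS => by
      rw [hx hxS, mul_zero]
  have hfS1 : ∫ x in S, f x = 1 := by simpa [hint] using hset fun _ => 1
  have hmul : ∀ x ∈ S, -f' x / f x * f x = -f' x := fun x hx =>
    div_mul_cancel₀ _ (hposS x hx).ne'
  have hgi : IntegrableOn (fun x => -f' x / f x * f x) S :=
    hf'int.neg.congr_fun (fun x hx => (hmul x hx).symm) hS
  have hgI : ∫ x in S, -f' x / f x * f x = f xl := by
    rw [setIntegral_congr_fun hS hmul, integral_neg, hf'S, neg_neg]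
  have hfxl : 0 ≤ f xl := by
    rw [← hgI, setIntegral_congr_fun hS hmul]
    exact setIntegral_nonneg hS fun x hx => neg_nonneg.2 (hneg x hx)
  have hganti : AntitoneOn (fun x => -f' x / f x) S := fun x hx y hy hxy => by
    have := hlogconvex x y (EReal.coe_lt_coe_iff.2 hx.1) hxy hy.2
    simp only [neg_div]
    linarith
  have hinv := hw.integral_le_inv hf0 hfi hint e
  obtain ⟨hmeas, -, hmono, hnn, hbud⟩ := hw
  have hle1 : ∀ y, w 0 y ≤ 1 := fun y =>
    (Finset.single_le_sum (fun k _ => hnn k y) (Finset.mem_univ 0)).trans (hbud y)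
  set v : ℝ → (Fin m → ℝ) → ℝ := fun x y => w 0 (Fin.cons (e + x) fun j => e + y j) with hv
  have hvm : Measurable (Function.uncurry v) := by
    refine (hmeas 0).comp (measurable_pi_iff.2 fun i => ?_)
    refine Fin.cases ?_ (fun j => ?_) i
    · simpa using measurable_fst.const_add e
    · have : Measurable fun z : ℝ × (Fin m → ℝ) => e + z.2 j := by fun_prop
      simpa using this
  have hvb : ∀ x y, ‖v x y‖ ≤ 1 := fun x y => by
    rw [Real.norm_eq_abs, abs_of_nonneg (hnn _ _)]; exact hle1 _
  have hP : Integrable (fun y : Fin m → ℝ => ∏ j, f (y j)) :=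
    Integrable.fintype_prod (f := fun _ => f) fun _ => hfi
  have hP0 : ∀ᵐ y : Fin m → ℝ, 0 ≤ ∏ j, f (y j) := by
    have : ∀ᵐ y : Fin m → ℝ, ∀ j, 0 ≤ f (y j) := ae_all_iff.2 fun j =>
      (Measure.quasiMeasurePreserving_eval (fun _ : Fin m => (volume : Measure ℝ)) j).ae hf0
    filter_upwards [this] with y hy using Finset.prod_nonneg fun j _ => hy j
  have hintegrable : ∀ {μ : Measure ℝ} [SFinite μ] {k : ℝ → ℝ}, Integrable k μ →
      Integrable (Function.uncurry fun (x : ℝ) (y : Fin m → ℝ) => v x y * k x * ∏ j, f (y j))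
        (μ.prod volume) := fun {μ} _ {k} hk => by
    have := (hk.mul_prod hP).bdd_mul (c := 1) hvm.aestronglyMeasurable
      (ae_of_all _ fun z => hvb z.1 z.2)
    refine this.congr (ae_of_all _ fun z => ?_)
    simp only [Function.uncurry]
    ring
  have hcheb : ∀ y : Fin m → ℝ, ∫ x in S, v x y * (-f' x) ≤ (∫ x, v x y * f x) * f xl := by
    intro y
    have h := setIntegral_mul_le_of_monotoneOn_of_antitoneOn (μ := volume) (h := fun x => v x y) hS
      (fun x hx => (hposS x hx).le) hfi.integrableOn hfS1 hgi hganti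
      (fun a _ b _ hab => hmono 0 _ _ (fun j hj => ?_) ?_)
      (hvm.comp measurable_prodMk_right).aestronglyMeasurable
      (fun x => hnn _ _) (fun x => hle1 _)
    · rw [hgI, hset] at h
      rwa [setIntegral_congr_fun hS (g := fun x => v x y * (-f' x / f x * f x))
        fun x hx => by simp only [hmul x hx]]
    · obtain ⟨k, rfl⟩ := Fin.exists_succ_eq.2 hj
      simp
    · simpa using hab
  have hswap : Rfun m f f' xl xu w e =
      ∫ y : Fin m → ℝ, (∫ x in S, v x y * (-f' x)) * ∏ j, f (y j) := by
    have : Rfun m f f' xl xu w e = -∫ x in S, ∫ y : Fin m → ℝ, v x y * f' x * ∏ j, f (y j) := rfl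
    rw [this, integral_integral_swap (hintegrable hf'int), ← integral_neg]
    refine integral_congr_ae (ae_of_all _ fun y => ?_)
    simp only [integral_mul_const, mul_neg, integral_neg, neg_mul]
  have hcons : ∀ z : ℝ × (Fin m → ℝ),
      (w 0 fun j => e + (MeasurableEquiv.piFinSuccAbove (fun _ => ℝ) 0).symm z j) *
        ∏ j, f ((MeasurableEquiv.piFinSuccAbove (fun _ => ℝ) 0).symm z j) =
      v z.1 z.2 * f z.1 * ∏ j, f (z.2 j) := by
    intro z
    have hz : (MeasurableEquiv.piFinSuccAbove (fun _ : Fin (m + 1) => ℝ) 0).symm z =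
        Fin.cons z.1 z.2 := by
      ext j
      simp [MeasurableEquiv.piFinSuccAbove]
    have hadd : (fun j => e + (Fin.cons z.1 z.2 : Fin (m + 1) → ℝ) j) =
        Fin.cons (e + z.1) fun j => e + z.2 j := by
      ext j
      refine Fin.cases ?_ (fun k => ?_) j <;> simp
    rw [hz, hadd, Fin.prod_univ_succ]
    simp only [Fin.cons_zero, Fin.cons_succ, hv, mul_assoc]
  have hfull : ∫ y : Fin m → ℝ, (∫ x, v x y * f x) * ∏ j, f (y j) =
      ∫ z : Fin (m + 1) → ℝ, w 0 (fun j => e + z j) * ∏ j, f (z j) := by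
    rw [← (volume_preserving_piFinSuccAbove (fun _ => ℝ) 0).symm.integral_comp',
      Measure.volume_eq_prod, integral_prod_symm]
    · refine integral_congr_ae (ae_of_all _ fun y => ?_)
      simp only [← integral_mul_const]
      refine integral_congr_ae (ae_of_all _ fun x => ?_)
      exact (hcons (x, y)).symm
    · exact (hintegrable hfi).congr (ae_of_all _ fun z => (hcons z).symm)
  rw [hswap]
  calc ∫ y : Fin m → ℝ, (∫ x in S, v x y * (-f' x)) * ∏ j, f (y j)
      ≤ ∫ y : Fin m → ℝ, f xl * ((∫ x, v x y * f x) * ∏ j, f (y j)) := by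
        refine integral_mono_ae ?_ ?_ ?_
        · refine (hintegrable hf'int.neg).integral_prod_right.congr (ae_of_all _ fun y => ?_)
          simp only [Function.uncurry, Pi.neg_apply, integral_mul_const]
        · refine ((hintegrable hfi).integral_prod_right.congr (ae_of_all _ fun y => ?_)).const_mul _
          simp [Function.uncurry, integral_mul_const]
        · filter_upwards [hP0] with y hy
          nlinarith [mul_le_mul_of_nonneg_right (hcheb y) hy]
    _ ≤ f xl * (1 / (m + 1 : ℝ)) := by
        rw [integral_const_mul, hfull]
        exact mul_le_mul_of_nonneg_left hinv hfxl
    _ = f xl / (m + 1 : ℝ) := by rw [mul_one_div]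
end

section
/- Let f : ℝ → ℝ be a continuous bounded probability density with CDF F(x) = ∫_{−∞}^x f(u) du, let ν be a probability measure on ℝ with CDF G, and fix e, ρ ∈ ℝ. Define Φ(a) = (1 − F(ρ − a))·G(ρ − e) + ∫_{(ρ−e, ∞)} (1 − F(e − a + x)) dν(x). Then Φ is differentiable at a = e with Φ'(e) = f(ρ − e)·G(ρ − e) + ∫_{(ρ−e, ∞)} f(x) dν(x). (The marginal effect of own effort on the probability of passing the standard and beating a competitor, evaluated at the symmetric point, equals the coefficient B in the tournament first-order condition.) -/
open MeasureTheory

/-- The integral of a continuous integrable function over `(-∞, x]` has derivative `f x`. -/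
theorem hasDerivAt_integral_Iic {f : ℝ → ℝ} (hfc : Continuous f) (hfi : Integrable f) (x : ℝ) :
    HasDerivAt (fun y => ∫ u in Set.Iic y, f u) (f x) x := by
  have heq : (fun y => ∫ u in Set.Iic y, f u) =
      fun y => (∫ u in Set.Iic x, f u) + ∫ u in x..y, f u := by
    funext y
    rw [← intervalIntegral.integral_Iic_sub_Iic hfi.integrableOn hfi.integrableOn]
    ring
  rw [heq]
  exact (hfc.integral_hasStrictDerivAt x x).hasDerivAt.const_add _

/-- The tail function of a continuous integrable `f`, evaluated at `c - a`, has derivative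
`f (c - a)` in `a`. -/
theorem hasDerivAt_one_sub_integral_Iic_sub {f : ℝ → ℝ} (hfc : Continuous f)
    (hfi : Integrable f) (c a : ℝ) :
    HasDerivAt (fun b => 1 - ∫ u in Set.Iic (c - b), f u) (f (c - a)) a := by
  simpa using ((hasDerivAt_integral_Iic hfc hfi (c - a)).comp a
    ((hasDerivAt_id a).const_sub c)).const_sub 1

/-- Differentiation under the integral sign for the averaged tail of a bounded continuous
integrable function. -/
theorem hasDerivAt_integral_one_sub_integral_Iic {f : ℝ → ℝ} (hfc : Continuous f)
    (hfi : Integrable f) {M : ℝ} (hM : ∀ x, ‖f x‖ ≤ M) (μ : Measure ℝ) [IsFiniteMeasure μ]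
    (e : ℝ) :
    HasDerivAt (fun a => ∫ x, (1 - ∫ u in Set.Iic (e - a + x), f u) ∂μ) (∫ x, f x ∂μ) e := by
  have hcont : Continuous fun y => ∫ u in Set.Iic y, f u :=
    continuous_iff_continuousAt.2 fun x => (hasDerivAt_integral_Iic hfc hfi x).continuousAt
  have hmeas (a : ℝ) :
      AEStronglyMeasurable (fun x => 1 - ∫ u in Set.Iic (e - a + x), f u) μ :=
    (continuous_const.sub (hcont.comp (by fun_prop))).aestronglyMeasurable
  have hint : Integrable (fun x => 1 - ∫ u in Set.Iic (e - e + x), f u) μ := by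
    refine Integrable.of_bound (hmeas e) (1 + ∫ u, ‖f u‖) (.of_forall fun x => ?_)
    refine (norm_sub_le _ _).trans ?_
    rw [norm_one]
    gcongr
    exact (norm_integral_le_integral_norm _).trans
      (setIntegral_le_integral hfi.norm (.of_forall fun u => norm_nonneg _))
  have key := (hasDerivAt_integral_of_dominated_loc_of_deriv_le (μ := μ) (x₀ := e)
    (F := fun a x => 1 - ∫ u in Set.Iic (e - a + x), f u) (F' := fun a x => f (e - a + x))
    (bound := fun _ => M) Filter.univ_mem (.of_forall hmeas) hint
    (hfc.comp (by fun_prop)).aestronglyMeasurable (.of_forall fun x a _ => hM _)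
    (integrable_const M) (.of_forall fun x a _ => by
      simpa only [add_sub_right_comm] using
        hasDerivAt_one_sub_integral_Iic_sub hfc hfi (e + x) a)).2
  simpa only [sub_self, zero_add] using key

/-- The marginal effect of own effort on the probability of passing the
standard and beating a competitor: with `F` the CDF of a continuous bounded density `f`
and `ν` a probability measure with CDF `G`, the map
`a ↦ (1 - F(ρ-a)) G(ρ-e) + ∫_{(ρ-e,∞)} (1 - F(e-a+x)) dν(x)` is differentiable at `a = e`
with derivative `f(ρ-e) G(ρ-e) + ∫_{(ρ-e,∞)} f(x) dν(x)`. -/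
theorem stmt16 (f : ℝ → ℝ) (hf0 : ∀ x, 0 ≤ f x) (hfc : Continuous f)
    (hfb : ∃ M, ∀ x, f x ≤ M) (hfi : ∫ x, f x = 1)
    (ν : Measure ℝ) [IsProbabilityMeasure ν]
    (G : ℝ → ℝ) (hG : ∀ x, G x = (ν (Set.Iic x)).toReal) (e ρ : ℝ) :
    HasDerivAt
      (fun a : ℝ =>
        (1 - ∫ u in Set.Iic (ρ - a), f u) * G (ρ - e) +
          ∫ x in Set.Ioi (ρ - e), (1 - ∫ u in Set.Iic (e - a + x), f u) ∂ν)
      (f (ρ - e) * G (ρ - e) + ∫ x in Set.Ioi (ρ - e), f x ∂ν) e := by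
  obtain ⟨M, hM⟩ := hfb
  have hint : Integrable f := Integrable.of_integral_ne_zero (by simp [hfi])
  have hnorm (x : ℝ) : ‖f x‖ ≤ M := by simpa [Real.norm_of_nonneg (hf0 x)] using hM x
  exact ((hasDerivAt_one_sub_integral_Iic_sub hfc hint ρ e).mul_const _).add
    (hasDerivAt_integral_one_sub_integral_Iic hfc hint hnorm _ e)
end

section
/- Let n ≥ 2 be an integer and e > 0. Define π_e : (0, ∞) → ℝ by π_e(a) = [a/(a + (n−1)e)]·[1 − exp(−(a + (n−1)e)/e)] (a player's winning probability in the Tullock contest with standard ρ = e when the player exerts effort a and each of the n−1 rivals exerts effort e). Then π_e is differentiable at a = e with π_e'(e) = ((n−1)/(n²e))·(1 − e^{−n}) + e^{−n}/(n·e); consequently, π_e'(e) = 1 if and only if e = (n−1)/n² + e^{−n}/n². (The symmetric equilibrium effort of the Tullock contest with linear costs and the optimal standard is e* = (n−1)/n² + e^{−n}/n².) -/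
/-- In the Tullock contest with standard `ρ = e`, linear costs and `n - 1`
rivals exerting effort `e`, the winning probability
`π_e(a) = [a/(a+(n-1)e)] [1 - exp(-(a+(n-1)e)/e)]` is differentiable at `a = e` with
`π_e'(e) = ((n-1)/(n²e))(1 - e^{-n}) + e^{-n}/(ne)`, and `π_e'(e) = 1` iff
`e = (n-1)/n² + e^{-n}/n²` (the symmetric equilibrium effort with the optimal standard). -/
theorem stmt19 (n : ℕ) (hn : 2 ≤ n) (e : ℝ) (he : 0 < e) :
    HasDerivAt
      (fun a : ℝ =>
        a / (a + ((n : ℝ) - 1) * e) * (1 - Real.exp (-((a + ((n : ℝ) - 1) * e) / e))))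
      (((n : ℝ) - 1) / ((n : ℝ) ^ 2 * e) * (1 - Real.exp (-(n : ℝ))) +
        Real.exp (-(n : ℝ)) / ((n : ℝ) * e)) e ∧
    ((((n : ℝ) - 1) / ((n : ℝ) ^ 2 * e) * (1 - Real.exp (-(n : ℝ))) +
        Real.exp (-(n : ℝ)) / ((n : ℝ) * e) = 1) ↔
      e = ((n : ℝ) - 1) / (n : ℝ) ^ 2 + Real.exp (-(n : ℝ)) / (n : ℝ) ^ 2) := by
  have hn0 : (n : ℝ) ≠ 0 := Nat.cast_ne_zero.mpr (by omega)
  have he0 : e ≠ 0 := he.ne'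
  have hsum : e + ((n : ℝ) - 1) * e = n * e := by ring
  refine ⟨?_, ?_⟩
  · have hden : HasDerivAt (fun a : ℝ => a + ((n : ℝ) - 1) * e) 1 e :=
      (hasDerivAt_id' e).add_const _
    have hden0 : e + ((n : ℝ) - 1) * e ≠ 0 := hsum ▸ mul_ne_zero hn0 he0
    have hexp := ((hden.div_const e).fun_neg.exp).const_sub 1
    have h := ((hasDerivAt_id' e).fun_div hden hden0).fun_mul hexp
    rw [hsum, mul_div_cancel_right₀ (n : ℝ) he0] at h
    refine h.congr_deriv ?_
    field_simp
  · have hderiv : ((n : ℝ) - 1) / ((n : ℝ) ^ 2 * e) * (1 - Real.exp (-(n : ℝ))) +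
        Real.exp (-(n : ℝ)) / ((n : ℝ) * e) =
        (((n : ℝ) - 1) / (n : ℝ) ^ 2 + Real.exp (-(n : ℝ)) / (n : ℝ) ^ 2) / e := by
      field_simp
      ring
    rw [hderiv, div_eq_one_iff_eq he0, eq_comm]
end
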